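/- arXiv:math/0601478 — 8 statements merged into one kernel-verified Lean document; each statement's English description precedes it below -/
import Mathlib

section
/- Let A be a unital C*-algebra, let p ∈ A be a projection (p = p* = p²), and let a ∈ A be a positive element with p ≾ a. Then there exists a positive element b ∈ A such that the diagonal matrix diag(p, b) ∈ M₂(A) is Cuntz equivalent to diag(a, 0) ∈ M₂(A). -/
open Filter Topology

/-- Cuntz subequivalence: `a ≾ b` iff there is a sequence `xₙ` with `xₙ * b * xₙ* → a`
(equivalently, `‖xₙ * b * xₙ* - a‖ → 0` in a normed setting). -/
def CuntzLE {M : Type*} [Mul M] [Star M] [TopologicalSpace M] (a b : M) : Prop :=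
  ∃ x : ℕ → M, Tendsto (fun n => x n * b * star (x n)) atTop (𝓝 a)

/-- Cuntz equivalence: `a ∼ b` iff `a ≾ b` and `b ≾ a`. -/
def CuntzEquiv {M : Type*} [Mul M] [Star M] [TopologicalSpace M] (a b : M) : Prop :=
  CuntzLE a b ∧ CuntzLE b a

theorem CuntzLE.of_eq {M : Type*} [Mul M] [Star M] [TopologicalSpace M] {a b : M} (x : M)
    (h : x * b * star x = a) : CuntzLE a b :=
  ⟨fun _ => x, by simp only [h]; exact tendsto_const_nhds⟩

theorem exists_isSelfAdjoint_commute_mul_mul_eq_one {A : Type*} [CStarAlgebra A] [PartialOrder A]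
    [StarOrderedRing A] {c p : A} (hc : 0 ≤ c) (hu : IsUnit c) (hcp : Commute c p) :
    ∃ r : A, star r = r ∧ Commute r p ∧ r * c * r = 1 := by
  refine ⟨c ^ (-(1 / 2) : ℝ), (IsSelfAdjoint.of_nonneg CFC.rpow_nonneg).star_eq,
    hcp.cfc_nnreal _, ?_⟩
  calc c ^ (-(1 / 2) : ℝ) * c * c ^ (-(1 / 2) : ℝ)
      = c ^ (-(1 / 2) : ℝ) * c ^ (1 : ℝ) * c ^ (-(1 / 2) : ℝ) := by rw [CFC.rpow_one c]
    _ = 1 := by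
      rw [← CFC.rpow_add hu, ← CFC.rpow_add hu]
      norm_num
      exact CFC.rpow_zero c

/-- A projection that is Cuntz subequivalent to a positive element `a` is exactly of the form
`v * a * star v`. -/
theorem CuntzLE.exists_mul_mul_star_eq {A : Type*} [CStarAlgebra A] [PartialOrder A]
    [StarOrderedRing A] {p a : A} (hp : IsStarProjection p) (ha : 0 ≤ a) (hpa : CuntzLE p a) :
    ∃ v : A, p * v = v ∧ v * a * star v = p := by
  obtain ⟨x, hx⟩ := hpa
  have hpp : p * p = p := hp.isIdempotentElem
  have hps : star p = p := hp.isSelfAdjoint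
  have hlim : Tendsto (fun n => p * (x n * a * star (x n)) * p + (1 - p)) atTop (𝓝 1) := by
    have h := ((hx.const_mul p).mul_const p).add_const (1 - p)
    simpa only [hpp, add_sub_cancel] using h
  obtain ⟨n, hn⟩ := (hlim.eventually (Units.isOpen.mem_nhds isUnit_one)).exists
  have hy₀ : 0 ≤ x n * a * star (x n) := star_right_conjugate_nonneg ha _
  generalize hy : x n * a * star (x n) = y at hn hy₀
  have hcp : Commute (p * y * p + (1 - p)) p := by
    simp only [Commute, SemiconjBy, add_mul, mul_add, sub_mul, mul_sub, one_mul, mul_one,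
      mul_assoc, hpp]
    simp only [← mul_assoc, hpp]
  have hc : 0 ≤ p * y * p + (1 - p) :=
    add_nonneg (hp.isSelfAdjoint.conjugate_nonneg hy₀) hp.one_sub.nonneg
  obtain ⟨r, hr, hrp, hrc⟩ := exists_isSelfAdjoint_commute_mul_mul_eq_one hc hn hcp
  have hpc : p * y * p = p * (p * y * p + (1 - p)) := by
    rw [mul_add, mul_sub, mul_one, hpp, sub_self, add_zero, ← mul_assoc, ← mul_assoc, hpp]
  refine ⟨r * p * x n, ?_, ?_⟩
  · rw [← mul_assoc, ← mul_assoc, ← hrp.eq, mul_assoc r, hpp]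
  · calc r * p * x n * a * star (r * p * x n)
        = r * (p * y * p) * r := by simp only [star_mul, hr, hps, ← hy, mul_assoc]
      _ = p * (r * (p * y * p + (1 - p)) * r) := by
        conv_lhs => rw [hpc, ← mul_assoc, hrp.eq]
        simp only [mul_assoc]
      _ = p := by rw [hrc, mul_one]

/-- If `p` is a projection in a unital C*-algebra, `a` is positive, and `p ≾ a`, then there is a
positive `b` with `diag (p, b)` Cuntz equivalent to `diag (a, 0)` in `M₂(A)`. -/
theorem projection_cuntz_complement {A : Type*} [CStarAlgebra A] [PartialOrder A]
    [StarOrderedRing A] (p a : A) (hp_star : star p = p) (hp_idem : p * p = p)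
    (ha : 0 ≤ a) (hpa : CuntzLE p a) :
    ∃ b : A, 0 ≤ b ∧
      CuntzEquiv (Matrix.diagonal ![p, b]) (Matrix.diagonal ![a, 0]) := by
  obtain ⟨v, hpv, hv⟩ := hpa.exists_mul_mul_star_eq ⟨hp_idem, hp_star⟩ ha
  have has : star a = a := (IsSelfAdjoint.of_nonneg ha).star_eq
  set z := 1 - a * star v * v with hz
  have hzs : star z = 1 - star v * v * a := by simp [hz, has, mul_assoc]
  have hvz : v * a * star z = 0 := by
    rw [hzs, mul_sub, mul_one, ← mul_assoc, ← mul_assoc, hv, hpv, sub_self]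
  have hzv : z * a * star v = 0 := by
    have h := congrArg star hvz
    simpa [has, mul_assoc] using h
  have hb : z * a * star z = a - a * star v * v * a := by
    have h : z * a * star z = a * star z - a * star v * (v * a * star z) := by
      rw [hz, sub_mul, one_mul, sub_mul]
      simp only [mul_assoc]
    rw [h, hvz, mul_zero, sub_zero, hzs, mul_sub, mul_one]
    simp only [mul_assoc]
  have hsum : a * star v * p * (v * a) + z * a * star z = a := by
    rw [hb, mul_assoc _ p, ← mul_assoc p, hpv, ← mul_assoc, add_sub_cancel]
  refine ⟨z * a * star z, star_right_conjugate_nonneg ha z,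
    CuntzLE.of_eq !![v, 0; z, 0] ?_, CuntzLE.of_eq !![a * star v, 1; 0, 0] ?_⟩
  · ext i j
    fin_cases i <;> fin_cases j <;>
      simp [Matrix.mul_apply, Matrix.star_apply, Matrix.vecMul_diagonal, hv, hvz, hzv]
  · ext i j
    fin_cases i <;> fin_cases j <;>
      simp [Matrix.mul_apply, Matrix.star_apply, Matrix.vecMul_diagonal, has, hsum]
end

section
/- Let A be a unital C*-algebra, let p ∈ A be a projection, and let a ∈ A be a positive element with p ≤ a. Then diag(p, (1−p)a(1−p)) ∈ M₂(A) is Cuntz equivalent to diag(a, 0) ∈ M₂(A). -/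
open Filter Topology

/-- In a unital C*-algebra, `0 ≤ x ≤ y` implies that `x` is Cuntz subequivalent to `y`. -/
theorem cuntzLE_of_nonneg_of_le {A : Type*} [CStarAlgebra A] [PartialOrder A]
    [StarOrderedRing A] {x y : A} (hx : 0 ≤ x) (hxy : x ≤ y) : CuntzLE x y := by
  have happrox (ε : ℝ) (hε : 0 < ε) : ∃ z : A, ‖z * y * star z - x‖ ≤ ε := by
    have hpos : IsStrictlyPositive (y + algebraMap ℝ A ε) :=
      .nonneg_add (hx.trans hxy) (isStrictlyPositive_algebraMap hε)
    set w := y + algebraMap ℝ A ε with hw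
    set h := w ^ (-(1 / 2) : ℝ)
    set t := CFC.sqrt x
    have hstar : star h = h := (IsSelfAdjoint.of_nonneg CFC.rpow_nonneg).star_eq
    have tstar : star t = t := (IsSelfAdjoint.of_nonneg (CFC.sqrt_nonneg x)).star_eq
    have htt : t * t = x := CFC.sqrt_mul_sqrt_self x hx
    have hconj : h * w * h = 1 := CFC.conjugate_rpow_neg_one_half w hpos
    have hle : h * x * h ≤ 1 := by
      have hxw : x ≤ w := hxy.trans (le_add_of_nonneg_right (algebraMap_nonneg A hε.le))
      have := star_left_conjugate_le_conjugate hxw h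
      rwa [hstar, hconj] at this
    have hnonneg : 0 ≤ h * x * h := by
      have := star_left_conjugate_nonneg hx h
      rwa [hstar] at this
    have hnorm : ‖t * h * (h * t)‖ ≤ 1 := by
      have h1 : t * h * (h * t) = star (h * t) * (h * t) := by simp [hstar, tstar]
      have h2 : h * x * h = (h * t) * star (h * t) := by
        simp [hstar, tstar, ← htt, mul_assoc]
      rw [h1, CStarRing.norm_star_mul_self, ← CStarRing.norm_self_mul_star, ← h2]
      exact (CStarAlgebra.norm_le_one_iff_of_nonneg _ hnonneg).2 hle
    refine ⟨t * h, ?_⟩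
    have hyh : h * y * h = 1 - ε • (h * h) := by
      rw [← hconj, hw, Algebra.algebraMap_eq_smul_one]
      simp [mul_add, add_mul]
    have key : t * h * y * star (t * h) - x = -(ε • (t * h * (h * t))) := by
      calc t * h * y * star (t * h) - x = t * (h * y * h) * t - t * t := by
            simp [hstar, tstar, htt, mul_assoc]
        _ = _ := by
            rw [hyh]
            simp [mul_sub, sub_mul, mul_assoc]
    rw [key, norm_neg, norm_smul, Real.norm_of_nonneg hε.le]
    exact mul_le_of_le_one_right hε.le hnorm
  choose z hz using fun n : ℕ => happrox (1 / ((n : ℝ) + 1)) Nat.one_div_pos_of_nat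
  exact ⟨z, tendsto_iff_norm_sub_tendsto_zero.2
    (squeeze_zero (fun _ => norm_nonneg _) hz tendsto_one_div_add_atTop_nhds_zero_nat)⟩

/-- In a unital C*-algebra, `0 ≤ x ≤ c y` for a scalar `c ≥ 0` implies that `x` is Cuntz
subequivalent to `y`. -/
theorem cuntzLE_of_nonneg_of_le_smul {A : Type*} [CStarAlgebra A] [PartialOrder A]
    [StarOrderedRing A] {x y : A} {c : ℝ} (hc : 0 ≤ c) (hx : 0 ≤ x) (hxy : x ≤ c • y) :
    CuntzLE x y := by
  obtain ⟨z, hz⟩ := cuntzLE_of_nonneg_of_le hx hxy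
  refine ⟨fun n => √c • z n, hz.congr fun n => ?_⟩
  simp [smul_smul, Real.mul_self_sqrt hc]

section Compression

variable {A : Type*} [CStarAlgebra A] [PartialOrder A] [StarOrderedRing A] {p a : A}

/-- The compression of `a ≥ 0` by a projection `p` is at most `‖a‖ p`. -/
theorem proj_mul_mul_proj_le (hp_star : star p = p) (hp_idem : p * p = p) (ha : 0 ≤ a) :
    p * a * p ≤ ‖a‖ • p := by
  have := star_left_conjugate_le_conjugate
    (IsSelfAdjoint.le_algebraMap_norm_self (IsSelfAdjoint.of_nonneg ha)) p
  rw [hp_star, Algebra.algebraMap_eq_smul_one] at this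
  simpa [hp_idem] using this

theorem proj_add_compression_le_smul (hp_star : star p = p) (hp_idem : p * p = p)
    (ha : 0 ≤ a) (hpa : p ≤ a) :
    p + (1 - p) * a * (1 - p) ≤ (3 + 2 * ‖a‖) • a := by
  have h1 : 0 ≤ (1 + p) * a * (1 + p) := by
    have := star_left_conjugate_nonneg ha (1 + p)
    rwa [star_add, star_one, hp_star] at this
  have h2 := proj_mul_mul_proj_le hp_star hp_idem ha
  have h3 : ‖a‖ • p ≤ ‖a‖ • a := smul_le_smul_of_nonneg_left hpa (norm_nonneg a)
  have h4 : p * a * p ≤ ‖a‖ • a := h2.trans h3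
  have e : (3 + 2 * ‖a‖) • a - (p + (1 - p) * a * (1 - p))
      = (a - p) + (1 + p) * a * (1 + p) + (‖a‖ • a - p * a * p) + (‖a‖ • a - p * a * p) := by
    simp only [add_smul, mul_smul, ofNat_smul_eq_nsmul]
    noncomm_ring
  rw [← sub_nonneg, e]
  exact add_nonneg (add_nonneg (add_nonneg (sub_nonneg.2 hpa) h1) (sub_nonneg.2 h4))
    (sub_nonneg.2 h4)

theorem compression_nonneg (hp_star : star p = p) (ha : 0 ≤ a) :
    0 ≤ (1 - p) * a * (1 - p) := by
  have := star_left_conjugate_nonneg ha (1 - p)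
  rwa [star_sub, star_one, hp_star] at this

theorem proj_nonneg (hp_star : star p = p) (hp_idem : p * p = p) : 0 ≤ p := by
  have := star_mul_self_nonneg p
  rwa [hp_star, hp_idem] at this

theorem le_smul_proj_add_compression (hp_star : star p = p) (hp_idem : p * p = p)
    (ha : 0 ≤ a) :
    a ≤ (2 + 2 * ‖a‖) • (p + (1 - p) * a * (1 - p)) := by
  have h1 : 0 ≤ (p - (1 - p)) * a * (p - (1 - p)) := by
    have := star_left_conjugate_nonneg ha (p - (1 - p))
    rwa [star_sub, star_sub, star_one, hp_star] at this
  have h2 := sub_nonneg.2 (proj_mul_mul_proj_le hp_star hp_idem ha)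
  have h3 : 0 ≤ ‖a‖ • ((1 - p) * a * (1 - p)) :=
    smul_nonneg (norm_nonneg a) (compression_nonneg hp_star ha)
  have h4 := proj_nonneg hp_star hp_idem
  have e : (2 + 2 * ‖a‖) • (p + (1 - p) * a * (1 - p)) - a
      = (p - (1 - p)) * a * (p - (1 - p)) + (‖a‖ • p - p * a * p) + (‖a‖ • p - p * a * p)
        + (p + p) + (‖a‖ • ((1 - p) * a * (1 - p)) + ‖a‖ • ((1 - p) * a * (1 - p))) := by
    simp only [add_smul, mul_smul, ofNat_smul_eq_nsmul, smul_add]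
    generalize ‖a‖ • p = u
    generalize ‖a‖ • ((1 - p) * a * (1 - p)) = v
    noncomm_ring
  rw [← sub_nonneg, e]
  positivity

end Compression

/-- If `p` is a projection in a unital C*-algebra and `a` is positive with `p ≤ a`, then
`diag (p, (1-p) a (1-p))` is Cuntz equivalent to `diag (a, 0)` in `M₂(A)`. -/
theorem diag_proj_compression_cuntzEquiv {A : Type*} [CStarAlgebra A] [PartialOrder A]
    [StarOrderedRing A] (p a : A) (hp_star : star p = p) (hp_idem : p * p = p)
    (ha : 0 ≤ a) (hpa : p ≤ a) :
    CuntzEquiv (Matrix.diagonal ![p, (1 - p) * a * (1 - p)]) (Matrix.diagonal ![a, 0]) := by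
  have hb : 0 ≤ p + (1 - p) * a * (1 - p) :=
    add_nonneg (proj_nonneg hp_star hp_idem) (compression_nonneg hp_star ha)
  obtain ⟨x, hx⟩ := cuntzLE_of_nonneg_of_le_smul (by positivity) hb
    (proj_add_compression_le_smul hp_star hp_idem ha hpa)
  obtain ⟨y, hy⟩ := cuntzLE_of_nonneg_of_le_smul (by positivity) ha
    (le_smul_proj_add_compression hp_star hp_idem ha)
  have hpq : p * (1 - p) = 0 := by rw [mul_sub, hp_idem, mul_one, sub_self]
  have hqp : (1 - p) * p = 0 := by rw [sub_mul, hp_idem, one_mul, sub_self]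
  have hqq : (1 - p) * (1 - p) = 1 - p := by rw [mul_sub, hqp, mul_one, sub_zero]
  have hq_star : star (1 - p) = 1 - p := by rw [star_sub, star_one, hp_star]
  generalize 1 - p = q at *
  constructor
  · refine ⟨fun n => !![p * x n, 0; q * x n, 0], ?_⟩
    have hcont : Continuous fun z : A => !![p * z * p, p * z * q; q * z * p, q * z * q] := by
      refine continuous_matrix fun i j => ?_
      fin_cases i <;> fin_cases j <;> simp <;> fun_prop
    have hlim := (hcont.tendsto _).comp hx
    have e : Matrix.diagonal ![p, q * a * q] = !![p * (p + q * a * q) * p,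
        p * (p + q * a * q) * q; q * (p + q * a * q) * p, q * (p + q * a * q) * q] := by
      have hpq' (z : A) : p * (q * z) = 0 := by rw [← mul_assoc, hpq, zero_mul]
      have hqq' (z : A) : q * (q * z) = q * z := by rw [← mul_assoc, hqq]
      ext i j
      fin_cases i <;> fin_cases j <;>
        simp [mul_add, mul_assoc, hp_idem, hpq, hqp, hqq, hpq', hqq']
    rw [e]
    refine hlim.congr fun n => ?_
    ext i j
    fin_cases i <;> fin_cases j <;>
      simp [Matrix.mul_apply, Fin.sum_univ_two, Matrix.vecMul_diagonal,
        mul_assoc, hp_star, hq_star]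
  · refine ⟨fun n => !![y n * p, y n * q; 0, 0], ?_⟩
    have hcont : Continuous fun z : A => Matrix.diagonal ![z, 0] := by
      refine continuous_matrix fun i j => ?_
      fin_cases i <;> fin_cases j <;> simp <;> fun_prop
    refine ((hcont.tendsto _).comp hy).congr fun n => ?_
    have hp' (z : A) : p * (p * z) = p * z := by rw [← mul_assoc, hp_idem]
    have hqq' (z : A) : q * (q * z) = q * z := by rw [← mul_assoc, hqq]
    ext i j
    fin_cases i <;> fin_cases j <;>
      simp [Matrix.mul_apply, Fin.sum_univ_two, Matrix.vecMul_diagonal,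
        mul_add, add_mul, mul_assoc, hp_star, hq_star,
        hp', hqq']
end

section
/- Let A be a C*-algebra, let p ∈ A be a projection, and let a ∈ A be a positive element with p ≾ a. Then there exist x ∈ A and λ > 0 such that q := a^{1/2} x* x a^{1/2} is a projection, q is Murray–von Neumann equivalent to p, and q ≤ λ·a. -/
open Filter Topology

/-- If `p` is a projection in a C*-algebra, `a` is positive and `p ≾ a`, then there exist
`x` and `λ > 0` such that `q := a^{1/2} x* x a^{1/2}` is a projection which is Murray–von
Neumann equivalent to `p` and satisfies `q ≤ λ • a`. -/
theorem projection_mvn_dominated {A : Type*} [CStarAlgebra A] [PartialOrder A]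
    [StarOrderedRing A] (p a : A) (hp_star : star p = p) (hp_idem : p * p = p)
    (ha : 0 ≤ a) (hpa : CuntzLE p a) :
    ∃ (x : A) (lam : ℝ), 0 < lam ∧
      star (CFC.sqrt a * (star x * x) * CFC.sqrt a) = CFC.sqrt a * (star x * x) * CFC.sqrt a ∧
      (CFC.sqrt a * (star x * x) * CFC.sqrt a) * (CFC.sqrt a * (star x * x) * CFC.sqrt a) =
        CFC.sqrt a * (star x * x) * CFC.sqrt a ∧
      (∃ v : A, p = v * star v ∧ CFC.sqrt a * (star x * x) * CFC.sqrt a = star v * v) ∧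
      CFC.sqrt a * (star x * x) * CFC.sqrt a ≤ lam • a := by
  obtain ⟨x, hx⟩ := hpa
  have hconv : Tendsto (fun n => p * x n * a * star (p * x n)) atTop (𝓝 p) := by
    have h := (hx.const_mul p).mul_const p
    rw [hp_idem, hp_idem] at h
    simpa only [star_mul, hp_star, mul_assoc] using h
  obtain ⟨n, hn⟩ := (Metric.tendsto_nhds.mp hconv 1 one_pos).exists
  rw [dist_eq_norm] at hn
  set y := p * x n with hy
  have hpy : p * y = y := by rw [hy, ← mul_assoc, hp_idem]
  have hyp : star y * p = star y := by simpa [hp_star] using congrArg star hpy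
  set b := y * a * star y + (1 - p) with hb
  have hb_nonneg : 0 ≤ b := by
    have h : 1 - p = star (1 - p) * (1 - p) := by
      simp [hp_star, mul_sub, sub_mul, hp_idem]
    refine add_nonneg (star_right_conjugate_nonneg ha y) ?_
    rw [h]
    exact star_mul_self_nonneg _
  have hb_unit : IsUnit b := by
    have h : ‖1 - b‖ < 1 := by
      have h' : 1 - b = -(y * a * star y - p) := by rw [hb]; abel
      rw [h']
      exact (norm_neg _).trans_lt hn
    simpa using isUnit_one_sub_of_norm_lt_one h
  have hpb : p * b = y * a * star y := by
    simp [hb, mul_add, mul_sub, hp_idem, ← mul_assoc, hpy]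
  have hbp : b * p = y * a * star y := by
    simp [hb, add_mul, sub_mul, hp_idem, mul_assoc, hyp]
  set c := b ^ (-(1 / 2) : ℝ) with hc
  have hcbc : c * b * c = 1 := CFC.conjugate_rpow_neg_one_half b (hb_unit.isStrictlyPositive hb_nonneg)
  have hc_star : star c = c := (CFC.rpow_nonneg (a := b)).isSelfAdjoint
  have hpc : Commute c p := Commute.cfc_nnreal (hbp.trans hpb.symm) _
  set z := c * y with hz
  have hpz : p * z = z := by rw [hz, ← mul_assoc, ← hpc.eq, mul_assoc, hpy]
  have hs : star (CFC.sqrt a) = CFC.sqrt a := (CFC.sqrt_nonneg a).isSelfAdjoint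
  have hv : p = (z * CFC.sqrt a) * star (z * CFC.sqrt a) := by
    calc p = p * (c * b * c) := by rw [hcbc, mul_one]
      _ = c * (p * b) * c := by simp only [← mul_assoc, hpc.eq]
      _ = c * (y * (CFC.sqrt a * CFC.sqrt a) * star y) * c := by
        rw [hpb, CFC.sqrt_mul_sqrt_self a ha]
      _ = _ := by simp only [hz, star_mul, hs, hc_star, mul_assoc]
  have hq : CFC.sqrt a * (star z * z) * CFC.sqrt a =
      star (z * CFC.sqrt a) * (z * CFC.sqrt a) := by
    simp only [star_mul, hs, mul_assoc]
  refine ⟨z, ‖z‖ ^ 2 + 1, by positivity, ?_, ?_, ⟨z * CFC.sqrt a, hv, hq⟩, ?_⟩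
  · rw [hq, star_mul, star_star]
  · calc _ = star (z * CFC.sqrt a) * ((z * CFC.sqrt a) * star (z * CFC.sqrt a)) *
          (z * CFC.sqrt a) := by rw [hq]; simp only [mul_assoc]
      _ = star (z * CFC.sqrt a) * (p * z * CFC.sqrt a) := by rw [← hv]; simp only [mul_assoc]
      _ = _ := by rw [hpz, hq]
  · have h1 : star z * z ≤ algebraMap ℝ A (‖z‖ ^ 2) := CStarAlgebra.star_mul_le_algebraMap_norm_sq
    have h2 := star_left_conjugate_le_conjugate h1 (CFC.sqrt a)
    rw [hs] at h2
    refine h2.trans ?_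
    rw [Algebra.algebraMap_eq_smul_one, mul_smul_comm, mul_one, smul_mul_assoc,
      CFC.sqrt_mul_sqrt_self a ha]
    exact smul_le_smul_of_nonneg_right (by linarith) ha
end

section
/- Let A be a unital C*-algebra, let a ∈ A be positive, let τ be a faithful tracial state on A, and let ε, η, δ be real numbers belonging to the spectrum σ(a) with ε < η < δ. Then d_τ((a−δ)₊) < d_τ((a−ε)₊). -/
open Filter Topology

open scoped ComplexOrder in
/-- A tracial state on a unital C*-algebra: a positive linear functional taking the
value `1` at `1` and satisfying the trace identity. -/
def IsTracialState {A : Type*} [CStarAlgebra A] [PartialOrder A] (τ : A →ₗ[ℂ] ℂ) : Prop :=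
  (∀ a : A, 0 ≤ a → 0 ≤ τ a) ∧ τ 1 = 1 ∧ ∀ x y : A, τ (x * y) = τ (y * x)

/-- `dTr τ a = lim_n τ(a^{1/n})`, the dimension function associated to a trace `τ`,
evaluated at a positive element `a`. -/
noncomputable def dTr {A : Type*} [CStarAlgebra A] (τ : A → ℂ) (a : A) : ℝ :=
  limUnder atTop fun n : ℕ => (τ (cfc (fun t : ℝ => t ^ ((n : ℝ)⁻¹)) a)).re

theorem IsTracialState.re_cfc_mono {A : Type*} [CStarAlgebra A] [PartialOrder A]
    [StarOrderedRing A] {τ : A →ₗ[ℂ] ℂ} (hτ : IsTracialState τ) (a : A) {f g : ℝ → ℝ}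
    (hf : Continuous f) (hg : Continuous g) (hfg : ∀ x ∈ spectrum ℝ a, f x ≤ g x) :
    (τ (cfc f a)).re ≤ (τ (cfc g a)).re := by
  have h := hτ.1 _ (sub_nonneg.2 (cfc_mono (a := a) hfg hf.continuousOn hg.continuousOn))
  rw [map_sub] at h
  simpa using (Complex.le_def.1 h).1

theorem continuous_rpow_inv_natCast_succ (n : ℕ) :
    Continuous fun t : ℝ => t ^ (((n + 1 : ℕ) : ℝ)⁻¹) :=
  continuous_id.rpow_const fun _ => Or.inr (by positivity)

/-- The sequence defining `dTr τ b` converges when `b` is positive. -/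
theorem IsTracialState.tendsto_dTr {A : Type*} [CStarAlgebra A] [PartialOrder A]
    [StarOrderedRing A] {τ : A →ₗ[ℂ] ℂ} (hτ : IsTracialState τ) {b : A} (hb : 0 ≤ b) :
    Tendsto (fun n : ℕ => (τ (cfc (fun t : ℝ => t ^ ((n : ℝ)⁻¹)) b)).re) atTop
      (𝓝 (dTr τ b)) := by
  suffices h : ∃ L, Tendsto (fun n : ℕ => (τ (cfc (fun t : ℝ => t ^ ((n : ℝ)⁻¹)) b)).re) atTop
      (𝓝 L) from tendsto_nhds_limUnder h
  obtain ⟨M, hM, hspec⟩ : ∃ M : ℝ, 0 < M ∧ ∀ t ∈ spectrum ℝ b, 0 ≤ t / M ∧ t / M ≤ 1 := by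
    obtain ⟨C, hC⟩ := (spectrum.isBounded b (𝕜 := ℝ)).bddAbove
    refine ⟨max C 1, by positivity, fun t ht => ⟨?_, ?_⟩⟩
    · have := spectrum_nonneg_of_nonneg hb ht
      positivity
    · exact div_le_one_of_le₀ ((hC ht).trans (le_max_left _ _)) (by positivity)
  let u : ℕ → ℝ := fun n => (τ (cfc (fun t : ℝ => (t / M) ^ (((n + 1 : ℕ) : ℝ)⁻¹)) b)).re
  have hcont (n : ℕ) : Continuous fun t : ℝ => (t / M) ^ (((n + 1 : ℕ) : ℝ)⁻¹) :=
    (continuous_rpow_inv_natCast_succ n).comp (continuous_id.div_const M)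
  have hu : Monotone u := fun m n hmn => hτ.re_cfc_mono b (hcont m) (hcont n) fun t ht =>
    Real.rpow_le_rpow_of_exponent_ge_of_imp (hspec t ht).1 (hspec t ht).2
      (by gcongr) (fun _ h => absurd h (by positivity))
  have hbdd : BddAbove (Set.range u) := by
    refine ⟨(τ (cfc (fun _ : ℝ => (1 : ℝ)) b)).re, ?_⟩
    rintro _ ⟨n, rfl⟩
    exact hτ.re_cfc_mono b (hcont n) continuous_const fun t ht =>
      Real.rpow_le_one (hspec t ht).1 (hspec t ht).2 (by positivity)
  refine ⟨⨆ n, u n, (tendsto_add_atTop_iff_nat 1).1 ?_⟩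
  have hpow : Tendsto (fun n : ℕ => M ^ (((n + 1 : ℕ) : ℝ)⁻¹)) atTop (𝓝 1) := by
    have h := (tendsto_inv_atTop_nhds_zero_nat (𝕜 := ℝ)).comp (tendsto_add_atTop_nat 1)
    have := (Real.continuousAt_const_rpow (b := 0) hM.ne').tendsto.comp h
    rwa [Real.rpow_zero] at this
  have key := hpow.mul (tendsto_atTop_ciSup hu hbdd)
  rw [one_mul] at key
  refine key.congr fun n => ?_
  have hscale : cfc (fun t : ℝ => t ^ (((n + 1 : ℕ) : ℝ)⁻¹)) b =
      M ^ (((n + 1 : ℕ) : ℝ)⁻¹) • cfc (fun t : ℝ => (t / M) ^ (((n + 1 : ℕ) : ℝ)⁻¹)) b := by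
    rw [← cfc_smul _ _ b (hcont n).continuousOn]
    refine cfc_congr fun t ht => ?_
    rw [smul_eq_mul, ← Real.mul_rpow hM.le (hspec t ht).1, mul_div_cancel₀ _ hM.ne']
  rw [hscale, ← Complex.coe_smul, map_smul, smul_eq_mul, Complex.re_ofReal_mul]

theorem min_one_le_rpow_inv_natCast_succ {s : ℝ} (hs : 0 ≤ s) (n : ℕ) :
    min s 1 ≤ s ^ (((n + 1 : ℕ) : ℝ)⁻¹) := by
  rcases le_total s 1 with h | h
  · rw [min_eq_left h]
    refine Real.self_le_rpow_of_le_one hs h (inv_le_one_of_one_le₀ ?_)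
    exact_mod_cast Nat.le_add_left 1 n
  · rw [min_eq_right h]
    exact Real.one_le_rpow h (by positivity)

/-- A bump function supported on `(ε, δ)` fits between the roots of the two cutdowns. -/
theorem rpow_cutdown_add_bump_le {ε δ : ℝ} (h : ε ≤ δ) (n : ℕ) (t : ℝ) :
    max (t - δ) 0 ^ (((n + 1 : ℕ) : ℝ)⁻¹) + min (max (δ - t) 0) (min (max (t - ε) 0) 1) ≤
      max (t - ε) 0 ^ (((n + 1 : ℕ) : ℝ)⁻¹) := by
  rcases le_total δ t with ht | ht
  · rw [max_eq_right (sub_nonpos.2 ht), min_eq_left (by positivity), add_zero]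
    gcongr
  · rw [max_eq_right (sub_nonpos.2 ht), Real.zero_rpow (by positivity), zero_add]
    exact (min_le_right _ _).trans
      (min_one_le_rpow_inv_natCast_succ (le_max_right _ _) n)

open scoped ComplexOrder in
/-- For a faithful tracial state `τ` and a positive element `a`, if `ε < η < δ` all belong to
the spectrum of `a`, then `d_τ((a - δ)₊) < d_τ((a - ε)₊)`. -/
theorem dTr_cutdown_strict_mono {A : Type*} [CStarAlgebra A] [PartialOrder A]
    [StarOrderedRing A] (τ : A →ₗ[ℂ] ℂ) (hτ : IsTracialState τ)
    (hfaithful : ∀ x : A, 0 ≤ x → x ≠ 0 → 0 < τ x)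
    (a : A) (ha : 0 ≤ a) (ε η δ : ℝ)
    (hε : ε ∈ spectrum ℝ a) (hη : η ∈ spectrum ℝ a) (hδ : δ ∈ spectrum ℝ a)
    (hεη : ε < η) (hηδ : η < δ) :
    dTr τ (cfc (fun t : ℝ => max (t - δ) 0) a) < dTr τ (cfc (fun t : ℝ => max (t - ε) 0) a) := by
  let g : ℝ → ℝ := fun t => min (max (δ - t) 0) (min (max (t - ε) 0) 1)
  have hg : Continuous g := by fun_prop
  have hgη : 0 < g η := by
    simp only [g, lt_min_iff, lt_max_iff, sub_pos]
    exact ⟨Or.inl hηδ, Or.inl hεη, one_pos⟩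
  have hg0 : 0 ≤ cfc g a := cfc_nonneg fun t _ => by positivity
  have hg_ne : cfc g a ≠ 0 := fun h => by
    have hmem : g η ∈ spectrum ℝ (cfc g a) := by
      rw [cfc_map_spectrum g a]
      exact Set.mem_image_of_mem g hη
    have : Nontrivial A := ⟨⟨cfc g a, 1, fun h1 => by
      have := hτ.2.1
      rw [← h1, h, map_zero] at this
      exact zero_ne_one this⟩⟩
    rw [h, spectrum.zero_eq, Set.mem_singleton_iff] at hmem
    exact hgη.ne' hmem
  have hpos : 0 < (τ (cfc g a)).re := (Complex.lt_def.1 (hfaithful _ hg0 hg_ne)).1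
  have htendsto (d : ℝ) := (tendsto_add_atTop_iff_nat 1).2 (hτ.tendsto_dTr
    (cfc_nonneg (a := a) fun t _ => le_max_right (t - d) 0))
  have hcut (d : ℝ) : Continuous fun t : ℝ => max (t - d) 0 := by fun_prop
  have hroot (d : ℝ) (n : ℕ) :
      Continuous fun t : ℝ => max (t - d) 0 ^ (((n + 1 : ℕ) : ℝ)⁻¹) :=
    (continuous_rpow_inv_natCast_succ n).comp (hcut d)
  have hcomp (d : ℝ) (n : ℕ) :
      cfc (fun t : ℝ => t ^ (((n + 1 : ℕ) : ℝ)⁻¹)) (cfc (fun t : ℝ => max (t - d) 0) a) =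
        cfc (fun t : ℝ => max (t - d) 0 ^ (((n + 1 : ℕ) : ℝ)⁻¹)) a :=
    (cfc_comp' _ _ a (continuous_rpow_inv_natCast_succ n).continuousOn
      (hcut d).continuousOn).symm
  refine (lt_add_of_pos_right _ hpos).trans_le
    (le_of_tendsto_of_tendsto' ((htendsto δ).add_const _) (htendsto ε) fun n => ?_)
  rw [hcomp, hcomp, ← Complex.add_re, ← map_add,
    ← cfc_add a _ _ (hroot δ n).continuousOn hg.continuousOn]
  exact hτ.re_cfc_mono a ((hroot δ n).add hg) (hroot ε n) fun t _ =>
    rpow_cutdown_add_bump_le (hεη.trans hηδ).le n t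
end

section
/- Let A be a simple unital C*-algebra which admits a faithful tracial state, and let a ∈ A be a positive element. Then a is Cuntz equivalent to some projection p ∈ A if and only if either 0 is not in the spectrum σ(a) or 0 is an isolated point of σ(a). -/
open Filter Topology

/-- The piecewise linear function that is `0` on `(-∞, δ/2]` and `1` on `[δ, ∞)`. -/
noncomputable def ramp (δ t : ℝ) : ℝ := max 0 (min 1 (2 * t / δ - 1))

lemma continuous_ramp (δ : ℝ) : Continuous (ramp δ) := by
  unfold ramp; fun_prop

lemma ramp_nonneg (δ t : ℝ) : 0 ≤ ramp δ t := le_max_left _ _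

lemma ramp_le_one (δ t : ℝ) : ramp δ t ≤ 1 := max_le zero_le_one (min_le_left _ _)

lemma ramp_of_le {δ t : ℝ} (hδ : 0 < δ) (h : t ≤ δ / 2) : ramp δ t = 0 := by
  have : 2 * t / δ ≤ 1 := by rw [div_le_one hδ]; linarith
  exact max_eq_left ((min_le_right _ _).trans (by linarith))

lemma ramp_of_ge {δ t : ℝ} (hδ : 0 < δ) (h : δ ≤ t) : ramp δ t = 1 := by
  have : 2 ≤ 2 * t / δ := by rw [le_div_iff₀ hδ]; linarith
  rw [ramp, min_eq_left (by linarith), max_eq_right zero_le_one]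

lemma ramp_anti {δ η t : ℝ} (hη : 0 < η) (h : η ≤ δ) (ht : 0 ≤ t) : ramp δ t ≤ ramp η t := by
  unfold ramp; gcongr

section PositiveTrace

variable {A : Type*} [CStarAlgebra A] [PartialOrder A] [StarOrderedRing A]

lemma positive_functional_mono {T : A →ₗ[ℝ] ℝ} (hT : ∀ x, 0 ≤ x → 0 ≤ T x) {x y : A}
    (h : x ≤ y) : T x ≤ T y := by
  have := hT (y - x) (sub_nonneg.2 h)
  rw [map_sub] at this
  linarith

lemma idempotent_le_one {q : A} (hs : star q = q) (hq : q * q = q) : q ≤ 1 := by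
  have h := star_mul_self_nonneg (1 - q)
  have h2 : star (1 - q) * (1 - q) = 1 - q := by
    simp [hs, mul_sub, sub_mul, hq]
  rwa [h2, sub_nonneg] at h

/-- If `e * s = s` and `x * s * s* * x*` is close to a projection `p`, then `p` is
equivalent to a projection dominated by `e * e`. -/
lemma trace_projection_le_of_norm_sub_lt {T : A →ₗ[ℝ] ℝ} (hT : ∀ x, 0 ≤ x → 0 ≤ T x)
    (htr : ∀ x y, T (x * y) = T (y * x)) {p s e x : A} (hps : star p = p) (hp : p * p = p)
    (hss : star s = s) (hes : star e = e) (he : e * s = s)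
    (h : ‖x * (s * s) * star x - p‖ < 1) : T p ≤ T (e * e) := by
  have hpn : ‖p‖ ≤ 1 := by
    have h1 : ‖p‖ * ‖p‖ = ‖p‖ := by rw [← CStarRing.norm_star_mul_self, hps, hp]
    nlinarith [norm_nonneg p]
  set z := s * star x * p with hz
  have hzs : star z = p * x * s := by simp [hz, hps, hss, mul_assoc]
  set c := star z * z with hc
  have hcp : c - p = p * (x * (s * s) * star x - p) * p := by
    rw [hc, hzs, hz, mul_sub, sub_mul, hp, hp]; simp only [mul_assoc]
  have hlt : ‖1 - (c + (1 - p))‖ < 1 := by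
    have h1 : 1 - (c + (1 - p)) = -(c - p) := by abel
    rw [h1, norm_neg, hcp]
    calc _ ≤ ‖p‖ * ‖x * (s * s) * star x - p‖ * ‖p‖ := norm_mul₃_le ..
      _ ≤ 1 * ‖x * (s * s) * star x - p‖ * 1 := by gcongr
      _ < 1 := by simpa using h
  have hu : IsUnit (c + (1 - p)) := by
    have := isUnit_one_sub_of_norm_lt_one hlt
    rwa [sub_sub_cancel] at this
  obtain ⟨r, hr1, hr2⟩ := isUnit_iff_exists.1 hu
  have hpc : p * c = c := by rw [hc, hzs]; simp only [← mul_assoc, hp]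
  have hcp' : c * p = c := by rw [hc, hz]; simp only [mul_assoc, hp]
  have hcr : c * r = p := by
    have := congrArg (p * ·) hr1
    simpa [← mul_assoc, mul_add, mul_sub, hp, hpc] using this
  have hcs : star (c + (1 - p)) = c + (1 - p) := by simp [hc, hps]
  have hrs : star r = r := by
    have h1 : (c + (1 - p)) * star r = 1 := by
      have := congrArg star hr2
      simpa only [star_mul, hcs, star_one] using this
    calc star r = r * (c + (1 - p)) * star r := by rw [hr2, one_mul]
      _ = r := by rw [mul_assoc, h1, mul_one]
  have hrc : r * c = p := by
    have := congrArg star hcr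
    rwa [star_mul, hrs, hps, show star c = c by simp [hc]] at this
  set q := z * r * star z with hq
  have hqs : star q = q := by simp [hq, hrs, mul_assoc]
  have hzp : z * p = z := by rw [hz, mul_assoc, hp]
  have hqq : q * q = q := by
    calc q * q = z * (r * (star z * z)) * r * star z := by simp only [hq, mul_assoc]
      _ = q := by rw [← hc, hrc, hzp]
  have hTq : T q = T p := by
    rw [hq, htr, ← mul_assoc, ← hc, hcr]
  have hez : e * z = z := by rw [hz, ← mul_assoc, ← mul_assoc, he]
  have hze : star z * e = star z := by
    have := congrArg star hez
    rwa [star_mul, hes] at this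
  have hqe : e * q * e = q := by
    rw [hq, ← mul_assoc, ← mul_assoc, hez, mul_assoc _ (star z), hze]
  rw [← hTq]
  apply positive_functional_mono hT
  have h1 := star_left_conjugate_le_conjugate (idempotent_le_one hqs hqq) e
  rwa [hes, hqe, mul_one] at h1

lemma exists_trace_projection_le_trace_ramp {T : A →ₗ[ℝ] ℝ} (hT : ∀ x, 0 ≤ x → 0 ≤ T x)
    (htr : ∀ x y, T (x * y) = T (y * x)) {a p : A} (ha : 0 ≤ a) (hps : star p = p)
    (hp : p * p = p) (h : CuntzLE p a) :
    ∃ δ > 0, T p ≤ T (cfc (fun t => ramp δ t * ramp δ t) a) := by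
  obtain ⟨x, hx⟩ := h
  rw [Metric.tendsto_atTop] at hx
  obtain ⟨n, hn⟩ := hx (1 / 2) (by norm_num)
  specialize hn n le_rfl
  rw [dist_eq_norm] at hn
  generalize x n = y at hn
  set δ : ℝ := 1 / (2 * (‖y‖ * ‖y‖ + 1)) with hδ
  have hδ0 : 0 < δ := by positivity
  refine ⟨δ, hδ0, ?_⟩
  have hsa : IsSelfAdjoint a := ha.isSelfAdjoint
  have hr := continuous_ramp δ
  rw [cfc_mul (ramp δ) (ramp δ) a hr.continuousOn hr.continuousOn]
  have hsc : Continuous fun t : ℝ => √(max (t - δ) 0) := by fun_prop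
  set s := cfc (fun t : ℝ => √(max (t - δ) 0)) a with hs
  have hss : s * s = cfc (fun t : ℝ => max (t - δ) 0) a := by
    rw [hs, ← cfc_mul _ _ a hsc.continuousOn hsc.continuousOn]
    exact cfc_congr fun t _ => Real.mul_self_sqrt (le_max_right _ _)
  have hsub : ‖s * s - a‖ ≤ δ := by
    conv_lhs => rw [hss]; arg 1; arg 2; rw [← cfc_id' ℝ a]
    rw [← cfc_sub _ _ a (by fun_prop) (by fun_prop)]
    refine norm_cfc_le hδ0.le fun t ht => ?_
    have ht0 := spectrum_nonneg_of_nonneg ha ht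
    rw [Real.norm_eq_abs, abs_le]
    rcases le_total (t - δ) 0 with h | h
    · rw [max_eq_right h]; constructor <;> linarith
    · rw [max_eq_left h]; constructor <;> linarith
  refine trace_projection_le_of_norm_sub_lt hT htr (s := s) (x := y) hps hp
    (cfc_predicate _ a : IsSelfAdjoint _) (cfc_predicate _ a : IsSelfAdjoint _) ?_ ?_
  · rw [hs, ← cfc_mul _ _ a hr.continuousOn hsc.continuousOn]
    refine cfc_congr fun t _ => ?_
    rcases le_total t δ with h | h
    · rw [max_eq_right (by linarith)]; simp
    · rw [ramp_of_ge hδ0 h, one_mul]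
  · have h1 : y * (s * s) * star y - p = y * (s * s - a) * star y + (y * a * star y - p) := by
      rw [mul_sub, sub_mul]; abel
    have h2 : ‖y * (s * s - a) * star y‖ ≤ 1 / 2 := by
      calc _ ≤ ‖y‖ * ‖s * s - a‖ * ‖star y‖ := norm_mul₃_le ..
        _ ≤ ‖y‖ * δ * ‖y‖ := by rw [norm_star]; gcongr
        _ ≤ 1 / 2 := by
          rw [hδ, mul_one_div, div_mul_eq_mul_div, div_le_div_iff₀ (by positivity) two_pos]
          linarith
    rw [h1]
    linarith [norm_add_le (y * (s * s - a) * star y) (y * a * star y - p)]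

lemma trace_ramp_le_trace_projection {T : A →ₗ[ℝ] ℝ} (hT : ∀ x, 0 ≤ x → 0 ≤ T x)
    (hT1 : T 1 = 1) (htr : ∀ x y, T (x * y) = T (y * x)) {a p : A} (ha : 0 ≤ a)
    (hps : star p = p) (hp : p * p = p) (h : CuntzLE a p) {η : ℝ} (hη : 0 < η) :
    T (cfc (ramp η) a) ≤ T p := by
  have hsa : IsSelfAdjoint a := ha.isSelfAdjoint
  set k := cfc (ramp η) a with hk
  have hk1 : ‖k‖ ≤ 1 := norm_cfc_le zero_le_one fun t _ => by
    rw [Real.norm_of_nonneg (ramp_nonneg _ _)]; exact ramp_le_one _ _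
  have hlc : Continuous fun t : ℝ => √(ramp η t / max t (η / 2)) :=
    ((continuous_ramp η).div (by fun_prop)
      fun t => (lt_of_lt_of_le (half_pos hη) (le_max_right _ _)).ne').sqrt
  set d := cfc (fun t : ℝ => √(ramp η t / max t (η / 2))) a with hd
  have hds : star d = d := (cfc_predicate _ a : IsSelfAdjoint _)
  have hdad : d * a * d = k := by
    conv_lhs => arg 1; arg 2; rw [← cfc_id' ℝ a]
    rw [hd, ← cfc_mul _ _ a hlc.continuousOn (by fun_prop),
      ← cfc_mul _ _ a (by fun_prop) hlc.continuousOn]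
    refine cfc_congr fun t ht => ?_
    have hm : 0 < max t (η / 2) := lt_of_lt_of_le (half_pos hη) (le_max_right _ _)
    rw [mul_right_comm, Real.mul_self_sqrt (div_nonneg (ramp_nonneg _ _) hm.le)]
    rcases le_total t (η / 2) with h | h
    · rw [ramp_of_le hη h]; simp
    · rw [max_eq_left h] at hm ⊢
      field_simp
  obtain ⟨x, hx⟩ := h
  have hlim : Tendsto (fun n => ‖d * (x n * p * star (x n)) * d - k‖) atTop (𝓝 0) := by
    rw [← tendsto_iff_norm_sub_tendsto_zero, ← hdad]
    exact (hx.const_mul d).mul_const d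
  have hle : ∀ n, T k ≤ (1 + ‖d * (x n * p * star (x n)) * d - k‖) * T p
      + ‖d * (x n * p * star (x n)) * d - k‖ := by
    intro n
    set v := d * x n * p with hv
    have hvv : d * (x n * p * star (x n)) * d = v * star v := by
      calc _ = d * x n * (p * p) * star (x n) * d := by rw [hp]; simp only [mul_assoc]
        _ = _ := by simp [hv, hps, hds, mul_assoc]
    rw [hvv]
    set ε := ‖v * star v - k‖
    have hks : IsSelfAdjoint (k - v * star v) :=
      (cfc_predicate _ a : IsSelfAdjoint k).sub (IsSelfAdjoint.mul_star_self v)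
    have h1 : T k - T (v * star v) ≤ ε := by
      have := positive_functional_mono hT hks.le_algebraMap_norm_self
      rwa [map_sub, Algebra.algebraMap_eq_smul_one, map_smul, hT1, norm_sub_rev, smul_eq_mul,
        mul_one] at this
    have h2 : ‖star v * v‖ ≤ 1 + ε := by
      rw [CStarRing.norm_star_mul_self, ← CStarRing.norm_self_mul_star]
      have := norm_add_le (v * star v - k) k
      rw [sub_add_cancel] at this
      linarith
    have h3 : star v * v ≤ (1 + ε) • p := by
      have hb : star v * v ≤ (1 + ε) • (1 : A) := by
        refine ((IsSelfAdjoint.star_mul_self v).le_algebraMap_norm_self).trans ?_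
        rw [← Algebra.algebraMap_eq_smul_one]
        exact algebraMap_mono A h2
      have hvp : v * p = v := by rw [hv, mul_assoc, hp]
      have hpv : p * star v = star v := by
        have := congrArg star hvp
        rwa [star_mul, hps] at this
      have := star_left_conjugate_le_conjugate hb p
      rwa [hps, ← mul_assoc, hpv, mul_assoc, hvp, mul_smul_comm, mul_one, smul_mul_assoc, hp]
        at this
    have h4 := positive_functional_mono hT h3
    rw [map_smul, smul_eq_mul, ← htr] at h4
    linarith
  refine ge_of_tendsto' (f := fun n => (1 + ‖d * (x n * p * star (x n)) * d - k‖) * T p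
      + ‖d * (x n * p * star (x n)) * d - k‖) (x := atTop) ?_ hle
  simpa using ((hlim.const_add 1).mul_const (T p)).add hlim

lemma zero_notMem_closure_of_cuntzEquiv {T : A →ₗ[ℝ] ℝ} (hT : ∀ x, 0 ≤ x → x ≠ 0 → 0 < T x)
    (hT1 : T 1 = 1) (htr : ∀ x y, T (x * y) = T (y * x)) {a p : A} (ha : 0 ≤ a)
    (hps : star p = p) (hp : p * p = p) (h : CuntzEquiv a p) :
    (0 : ℝ) ∉ closure (spectrum ℝ a \ {0}) := by
  intro h0
  have hT' : ∀ x, 0 ≤ x → 0 ≤ T x := fun x hx => by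
    rcases eq_or_ne x 0 with rfl | h
    · simp
    · exact (hT x hx h).le
  have hsa : IsSelfAdjoint a := ha.isSelfAdjoint
  obtain ⟨δ, hδ, h1⟩ := exists_trace_projection_le_trace_ramp hT' htr ha hps hp h.2
  obtain ⟨η, ⟨hησ, hη0⟩, hηδ⟩ := Metric.mem_closure_iff.1 h0 (δ / 2) (half_pos hδ)
  have hη : 0 < η := lt_of_le_of_ne (spectrum_nonneg_of_nonneg ha hησ) (Ne.symm hη0)
  rw [Real.dist_eq, zero_sub, abs_neg, abs_of_pos hη] at hηδ
  have h2 := trace_ramp_le_trace_projection hT' hT1 htr ha hps hp h.1 hη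
  have hδc := continuous_ramp δ
  have hηc := continuous_ramp η
  have hgc : Continuous fun t => ramp η t - ramp δ t * ramp δ t := by fun_prop
  have h3 := hT (cfc (fun t => ramp η t - ramp δ t * ramp δ t) a)
    (cfc_nonneg fun t ht => by
      have := ramp_anti hη (by linarith : η ≤ δ) (spectrum_nonneg_of_nonneg ha ht)
      nlinarith [ramp_nonneg δ t, ramp_le_one δ t])
    (fun hz => by
      have hm : (1 : ℝ) ∈ spectrum ℝ (cfc (fun t => ramp η t - ramp δ t * ramp δ t) a) := by
        rw [cfc_map_spectrum _ a hsa hgc.continuousOn]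
        exact ⟨η, hησ, by simp [ramp_of_ge hη le_rfl, ramp_of_le hδ hηδ.le]⟩
      have : Nontrivial A := ⟨⟨1, 0, fun h => by simp [h] at hT1⟩⟩
      rw [hz, spectrum.zero_eq] at hm
      simp at hm)
  rw [cfc_sub (ramp η) (fun t => ramp δ t * ramp δ t) a hηc.continuousOn
    (hδc.mul hδc).continuousOn, map_sub] at h3
  linarith

lemma exists_projection_cuntzEquiv {a : A} (ha : 0 ≤ a)
    (h : (0 : ℝ) ∉ closure (spectrum ℝ a \ {0})) :
    ∃ p : A, star p = p ∧ p * p = p ∧ CuntzEquiv a p := by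
  have hsa : IsSelfAdjoint a := ha.isSelfAdjoint
  rw [Metric.mem_closure_iff] at h
  push Not at h
  obtain ⟨ε, hε, h⟩ := h
  have hσ : ∀ t ∈ spectrum ℝ a, t = 0 ∨ ε ≤ t := fun t ht => by
    by_cases h0 : t = 0
    · exact .inl h0
    · have := h t ⟨ht, h0⟩
      rw [Real.dist_eq, zero_sub, abs_neg, abs_of_nonneg (spectrum_nonneg_of_nonneg ha ht)] at this
      exact .inr this
  have hm (t : ℝ) : 0 < max t ε := lt_of_lt_of_le hε (le_max_right _ _)
  have hpc : Continuous fun t : ℝ => t / max t ε :=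
    continuous_id.div (by fun_prop) fun t => (hm t).ne'
  have hgc : Continuous fun t : ℝ => (√(max t ε))⁻¹ :=
    Continuous.inv₀ (by fun_prop) fun t => (Real.sqrt_pos.2 (hm t)).ne'
  have hsc : Continuous fun t : ℝ => √t := Real.continuous_sqrt
  refine ⟨cfc (fun t : ℝ => t / max t ε) a, (cfc_predicate _ a : IsSelfAdjoint _), ?_,
    ⟨fun _ => cfc (fun t : ℝ => √t) a, ?_⟩, ⟨fun _ => cfc (fun t : ℝ => (√(max t ε))⁻¹) a, ?_⟩⟩
  · rw [← cfc_mul _ _ a hpc.continuousOn hpc.continuousOn]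
    refine cfc_congr fun t ht => ?_
    rcases hσ t ht with rfl | h
    · simp
    · simp [max_eq_left h, (hε.trans_le h).ne']
  · have : cfc (fun t : ℝ => √t) a * cfc (fun t : ℝ => t / max t ε) a *
        star (cfc (fun t : ℝ => √t) a) = a := by
      rw [(cfc_predicate _ a : IsSelfAdjoint (cfc (fun t : ℝ => √t) a)).star_eq,
        ← cfc_mul _ _ a hsc.continuousOn hpc.continuousOn,
        ← cfc_mul (fun t => √t * (t / max t ε)) _ a (hsc.mul hpc).continuousOn hsc.continuousOn]
      conv_rhs => rw [← cfc_id' ℝ a]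
      refine cfc_congr fun t ht => ?_
      rcases hσ t ht with rfl | h
      · simp
      · simp [max_eq_left h, (hε.trans_le h).ne', Real.mul_self_sqrt (hε.le.trans h)]
    simpa only [this] using tendsto_const_nhds
  · have : cfc (fun t : ℝ => (√(max t ε))⁻¹) a * a *
        star (cfc (fun t : ℝ => (√(max t ε))⁻¹) a) = cfc (fun t : ℝ => t / max t ε) a := by
      rw [(cfc_predicate _ a : IsSelfAdjoint (cfc (fun t : ℝ => (√(max t ε))⁻¹) a)).star_eq]
      conv_lhs => arg 1; arg 2; rw [← cfc_id' ℝ a]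
      rw [← cfc_mul _ _ a hgc.continuousOn (by fun_prop),
        ← cfc_mul (fun t => (√(max t ε))⁻¹ * t) _ a (hgc.mul continuous_id).continuousOn
          hgc.continuousOn]
      refine cfc_congr fun t ht => ?_
      rw [mul_right_comm, ← mul_inv, Real.mul_self_sqrt (hm t).le, mul_comm, div_eq_mul_inv]
    simpa only [this] using tendsto_const_nhds

end PositiveTrace

open scoped ComplexOrder in
/-- In a simple unital C*-algebra admitting a faithful tracial state, a positive element `a`
is Cuntz equivalent to a projection if and only if `0 ∉ σ(a)` or `0` is an isolated point
of `σ(a)`. -/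
theorem cuntzEquiv_projection_iff {A : Type*} [CStarAlgebra A] [PartialOrder A]
    [StarOrderedRing A]
    (hsimple : ∀ I : TwoSidedIdeal A, IsClosed (I : Set A) → I = ⊥ ∨ I = ⊤)
    (hstate : ∃ τ : A →ₗ[ℂ] ℂ, IsTracialState τ ∧ ∀ x : A, 0 ≤ x → x ≠ 0 → 0 < τ x)
    (a : A) (ha : 0 ≤ a) :
    (∃ p : A, star p = p ∧ p * p = p ∧ CuntzEquiv a p) ↔
      ((0 : ℝ) ∉ spectrum ℝ a ∨
        ((0 : ℝ) ∈ spectrum ℝ a ∧ (0 : ℝ) ∉ closure (spectrum ℝ a \ {0}))) := by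
  obtain ⟨τ, ⟨-, hτ1, hτtr⟩, hτ⟩ := hstate
  let T : A →ₗ[ℝ] ℝ := Complex.reLm ∘ₗ τ.restrictScalars ℝ
  constructor
  · rintro ⟨p, hps, hp, h⟩
    have := zero_notMem_closure_of_cuntzEquiv (T := T)
      (fun x hx hx0 => (Complex.pos_iff.1 (hτ x hx hx0)).1) (by simp [T, hτ1])
      (fun x y => by simp [T, hτtr x y]) ha hps hp h
    tauto
  · intro h
    apply exists_projection_cuntzEquiv ha
    rcases h with h | h
    · exact fun h0 => h (closure_minimal Set.sdiff_subset (spectrum.isClosed a) h0)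
    · exact h.2
end

section
/- Let A be a simple unital C*-algebra which admits a faithful tracial state. Let a, b ∈ A be positive elements such that neither a nor b is Cuntz equivalent to any projection in A. Then diag(a, b) ∈ M₂(A) is not Cuntz equivalent to any projection in M₂(A). -/
open Filter Topology

lemma Commute.ringInverse_right {M₀ : Type*} [MonoidWithZero M₀] {a b : M₀} (h : Commute a b) :
    Commute a (Ring.inverse b) := by
  by_cases hb : IsUnit b
  · obtain ⟨u, rfl⟩ := hb
    rw [Ring.inverse_unit]
    exact h.units_inv_right
  · rw [Ring.inverse_non_unit _ hb]
    exact Commute.zero_right a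

/-- A projection Cuntz subequivalent to `s * s` is trace-equivalent to a projection of the form
`s * z * s`. -/
lemma exists_projection_of_cuntzLE {B : Type*} [CStarAlgebra B] {τ : B →ₗ[ℝ] ℝ}
    (htr : ∀ x y, τ (x * y) = τ (y * x)) {q s : B} (hqs : star q = q) (hq : q * q = q) (hs : star s = s)
    (hle : CuntzLE q (s * s)) :
    ∃ z : B, IsSelfAdjoint z ∧ s * z * s * (s * z * s) = s * z * s ∧ τ (s * z * s) = τ q := by
  obtain ⟨x, hx⟩ := hle
  have hlim : Tendsto (fun n => q - q * (x n * (s * s) * star (x n)) * q) atTop (𝓝 0) := by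
    have := (hx.const_mul q).mul_const q
    simpa [hq] using this.const_sub q
  obtain ⟨n, hn⟩ := (hlim.norm.eventually_lt_const (u := 1) (by simp)).exists
  set y := x n
  set m := q * (y * (s * s) * star y) * q with hm
  have hu : IsUnit (1 - (q - m)) := isUnit_one_sub_of_norm_lt_one hn
  set u := 1 - (q - m) with hudef
  have hms : star m = m := by simp [hm, hqs, hs, mul_assoc]
  have hqm : q * m = m := by simp only [hm, ← mul_assoc, hq]
  have hmq : m * q = m := by simp only [hm, mul_assoc, hq]
  have hqu : q * u = m := by simp [hudef, mul_sub, hq, hqm]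
  have huq : u * q = m := by simp [hudef, sub_mul, hq, hmq]
  have hus : star u = u := by simp [hudef, hqs, hms]
  set v := Ring.inverse u with hv
  have huv : u * v = 1 := Ring.mul_inverse_cancel _ hu
  have hvu : v * u = 1 := Ring.inverse_mul_cancel _ hu
  have hvs : star v = v := by
    have h1 : star v * u = 1 := by simpa [hus] using congrArg star huv
    calc star v = star v * (u * v) := by rw [huv, mul_one]
      _ = v := by rw [← mul_assoc, h1, one_mul]
  have hmv : m * v = q := by rw [← hqu, mul_assoc, huv, mul_one]
  have hvm : v * m = q := by rw [← huq, ← mul_assoc, hvu, one_mul]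
  have hvq : q * v = v * q := by rw [← hmv, ← mul_assoc]; nth_rw 1 [hmv, ← hvm]
  refine ⟨star y * (q * v * q) * y, ?_, ?_, ?_⟩
  · simp [isSelfAdjoint_iff, hqs, hvs, mul_assoc]
  · calc _ = s * star y * q * v * m * v * q * y * s := by simp only [hm, mul_assoc]
      _ = s * star y * q * (v * m) * v * q * y * s := by simp only [mul_assoc]
      _ = s * star y * (q * q) * v * q * y * s := by rw [hvm]; simp only [mul_assoc]
      _ = _ := by rw [hq]; simp only [mul_assoc]
  · calc _ = τ ((s * star y * q) * (v * q * y * s)) := by simp only [mul_assoc]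
      _ = τ (v * m) := by rw [htr]; simp only [hm, mul_assoc]
      _ = τ q := by rw [hvm]

section TraceLemmas

variable {B : Type*} [CStarAlgebra B] [PartialOrder B] [StarOrderedRing B]

lemma exists_eq_star_mul_self_of_nonneg {x : B} (hx : 0 ≤ x) : ∃ u, x = star u * u :=
  CStarAlgebra.nonneg_iff_eq_star_mul_self.mp hx

lemma isStrictlyPositive_add_smul_one {c : B} (hc : 0 ≤ c) {δ : ℝ} (hδ : 0 < δ) :
    IsStrictlyPositive (c + δ • (1 : B)) :=
  .nonneg_add hc (isStrictlyPositive_one.smul hδ)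

lemma trace_mul_nonneg {τ : B →ₗ[ℝ] ℝ} (hpos : ∀ x, 0 ≤ x → 0 ≤ τ x)
    (htr : ∀ x y, τ (x * y) = τ (y * x)) {x y : B} (hx : 0 ≤ x) (hy : 0 ≤ y) :
    0 ≤ τ (x * y) := by
  obtain ⟨u, rfl⟩ := exists_eq_star_mul_self_of_nonneg hx
  rw [mul_assoc, htr]
  exact hpos _ (star_right_conjugate_nonneg hy u)

lemma trace_resolvent_le_of_mul_eq {τ : B →ₗ[ℝ] ℝ} (hpos : ∀ x, 0 ≤ x → 0 ≤ τ x)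
    (htr : ∀ x y, τ (x * y) = τ (y * x)) {q w : B} (hqs : star q = q) (hq : q * q = q)
    (hw : w * q = w) {δ : ℝ} (hδ : 0 < δ) :
    τ (w * star w * Ring.inverse (w * star w + δ • (1 : B))) ≤ τ q := by
  have hU := (isStrictlyPositive_add_smul_one (star_mul_self_nonneg w) hδ)
  have hV := (isStrictlyPositive_add_smul_one (mul_star_self_nonneg w) hδ)
  set U := star w * w + δ • (1 : B) with hUdef
  set V := w * star w + δ • (1 : B) with hVdef
  have h1 : w * U = V * w := by simp [hUdef, hVdef, mul_add, add_mul, mul_assoc]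
  have h2 : Ring.inverse V * w = w * Ring.inverse U := by
    calc Ring.inverse V * w = Ring.inverse V * (w * U) * Ring.inverse U := by
          rw [mul_assoc, mul_assoc, Ring.mul_inverse_cancel _ hU.isUnit, mul_one]
      _ = w * Ring.inverse U := by
          rw [h1, ← mul_assoc, Ring.inverse_mul_cancel _ hV.isUnit, one_mul]
  have h3 : Ring.inverse U * (star w * w) = q - δ • (Ring.inverse U * q) := by
    have : star w * w = U * q - δ • q := by
      simp [hUdef, add_mul, mul_assoc, hw]
    rw [this, mul_sub, ← mul_assoc, Ring.inverse_mul_cancel _ hU.isUnit, one_mul, mul_smul_comm]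
  have h4 : 0 ≤ Ring.inverse U := hU.ringInverse.nonneg
  have h5 : 0 ≤ τ (Ring.inverse U * q) := by
    refine trace_mul_nonneg hpos htr h4 ?_
    rw [← hq]; nth_rw 1 [← hqs]; exact star_mul_self_nonneg q
  have h6 : τ (w * star w * Ring.inverse V) = τ (Ring.inverse U * (star w * w)) := by
    rw [mul_assoc, htr, mul_assoc, h2, ← mul_assoc, htr]
  rw [h6, h3, map_sub, map_smul, smul_eq_mul]
  nlinarith

lemma trace_resolvent_le_of_cuntzLE {τ : B →ₗ[ℝ] ℝ} (hcont : Continuous τ)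
    (hpos : ∀ x, 0 ≤ x → 0 ≤ τ x) (htr : ∀ x y, τ (x * y) = τ (y * x)) {q c : B}
    (hqs : star q = q) (hq : q * q = q) (hc : 0 ≤ c) (hle : CuntzLE c q) {δ : ℝ} (hδ : 0 < δ) :
    τ (c * Ring.inverse (c + δ • (1 : B))) ≤ τ q := by
  obtain ⟨x, hx⟩ := hle
  have hinv : ContinuousAt Ring.inverse (c + δ • (1 : B)) := by
    obtain ⟨u, hu⟩ := (isStrictlyPositive_add_smul_one hc hδ).isUnit
    rw [← hu]
    exact NormedRing.inverse_continuousAt u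
  have hlim := (hcont.tendsto _).comp (hx.mul (hinv.tendsto.comp (hx.add_const (δ • (1 : B)))))
  refine le_of_tendsto' hlim fun n => ?_
  have hw : x n * q * q = x n * q := by rw [mul_assoc, hq]
  have := trace_resolvent_le_of_mul_eq hpos htr hqs hq hw hδ
  have hxx : x n * q * star (x n * q) = x n * q * star (x n) := by
    rw [star_mul, hqs, ← mul_assoc, hw]
  rwa [hxx] at this

lemma le_smul_resolvent {c : B} (hc : 0 ≤ c) {δ M : ℝ} (hδ : 0 < δ) (hM : ‖c‖ + δ ≤ M) :
    c ≤ M • (c * Ring.inverse (c + δ • (1 : B))) := by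
  have hV := isStrictlyPositive_add_smul_one hc hδ
  set V := c + δ • (1 : B) with hVdef
  have hcV : Commute c V := by simp [hVdef, Commute, SemiconjBy, mul_add, add_mul]
  have hcR : Commute c (Ring.inverse V) := Commute.ringInverse_right hcV
  have hle : 0 ≤ M • (1 : B) - V := by
    have h1 : c ≤ algebraMap ℝ B ‖c‖ := IsSelfAdjoint.le_algebraMap_norm_self hc.isSelfAdjoint
    have h2 : (M • (1 : B) - V) = (algebraMap ℝ B ‖c‖ - c) + (M - (‖c‖ + δ)) • (1 : B) := by
      rw [hVdef, Algebra.algebraMap_eq_smul_one]; module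
    rw [h2]
    exact add_nonneg (sub_nonneg.mpr h1) (smul_nonneg (by linarith) zero_le_one)
  have h3 : 0 ≤ c * Ring.inverse V := hcR.mul_nonneg hc hV.ringInverse.nonneg
  have hcomm : Commute (c * Ring.inverse V) V :=
    hcV.mul_left (Commute.ringInverse_right (Commute.refl V)).symm
  have h4 : 0 ≤ (c * Ring.inverse V) * (M • (1 : B) - V) :=
    Commute.mul_nonneg h3 hle
      (((Commute.one_right _).smul_right M).sub_right hcomm)
  rw [← sub_nonneg]
  convert h4 using 1
  rw [mul_sub, mul_assoc c _ V, Ring.inverse_mul_cancel _ hV.isUnit]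
  simp

/-- A positive element Cuntz equivalent to a projection, in the presence of a faithful trace, is
dominated by a multiple of its square. -/
lemma exists_le_smul_sq_of_cuntzEquiv {τ : B →ₗ[ℝ] ℝ} (hcont : Continuous τ)
    (hpos : ∀ x, 0 ≤ x → 0 ≤ τ x) (hfaith : ∀ x, 0 ≤ x → τ x = 0 → x = 0)
    (htr : ∀ x y, τ (x * y) = τ (y * x)) {q c : B} (hqs : star q = q) (hq : q * q = q)
    (hc : 0 ≤ c) (heq : CuntzEquiv c q) : ∃ K : ℝ, c ≤ K • (c * c) := by
  set s := CFC.sqrt c with hsdef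
  have hsc : s * s = c := CFC.sqrt_mul_sqrt_self c hc
  have hs : star s = s := (CFC.sqrt_nonneg c).isSelfAdjoint
  obtain ⟨z, hz, hpp, hpq⟩ := exists_projection_of_cuntzLE htr hqs hq hs (hsc.symm ▸ heq.2)
  set p := s * z * s with hpdef
  have hps : star p = p := by simp [hpdef, hs, hz.star_eq, mul_assoc]
  have hp1s : star (1 - p) = 1 - p := by simp [hps]
  have hp1p : (1 - p) * (1 - p) = 1 - p := by simp [mul_sub, sub_mul, hpp]
  have hp1 : 0 ≤ 1 - p := by
    rw [← hp1p]; nth_rw 1 [← hp1s]; exact star_mul_self_nonneg _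
  have hzK : 0 ≤ ‖z‖ • (1 : B) - z := by
    rw [sub_nonneg, ← Algebra.algebraMap_eq_smul_one]; exact hz.le_algebraMap_norm_self
  have key : ∀ δ : ℝ, 0 < δ → δ ≤ 1 →
      τ ((1 - p) * c) ≤ δ * ((‖c‖ + 1) * ‖z‖ * τ q) := by
    intro δ hδ hδ1
    have hV := isStrictlyPositive_add_smul_one hc hδ
    set V := c + δ • (1 : B) with hVdef
    set R := Ring.inverse V with hR
    have hsV : Commute s V := by
      simp [hVdef, ← hsc, Commute, SemiconjBy, mul_add, add_mul, mul_assoc]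
    have hsR : Commute s R := Commute.ringInverse_right hsV
    have hsRs : s * R * s = c * R := by rw [mul_assoc, ← hsR.eq, ← mul_assoc, hsc]
    have hk : 0 ≤ c * R := by
      rw [← hsRs]; nth_rw 1 [← hs]; exact star_left_conjugate_nonneg hV.ringInverse.nonneg s
    have hkq : τ (c * R) ≤ τ q :=
      trace_resolvent_le_of_cuntzLE hcont hpos htr hqs hq hc heq.1 hδ
    have hone : c * R = 1 - δ • R := by
      have : V * R = 1 := Ring.mul_inverse_cancel _ hV.isUnit
      rw [hVdef, add_mul, smul_one_mul] at this
      rw [← this]; abel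
    have hpR : τ (p * R) = τ (z * (c * R)) := by
      rw [hpdef, mul_assoc, mul_assoc, htr, mul_assoc, ← hsRs, hsR.eq]
    have hzk : τ (z * (c * R)) ≤ ‖z‖ * τ (c * R) := by
      have := trace_mul_nonneg hpos htr hzK hk
      rw [sub_mul, map_sub, smul_one_mul, map_smul, smul_eq_mul] at this
      linarith
    have hpk : τ (p * (c * R)) = τ q - δ * τ (z * (c * R)) := by
      rw [hone, mul_sub, mul_one, mul_smul_comm, map_sub, map_smul, smul_eq_mul, hpR, hpq, hone]
    have hM := trace_mul_nonneg hpos htr hp1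
      (sub_nonneg.mpr (le_smul_resolvent hc hδ (M := ‖c‖ + 1) (by linarith)))
    rw [mul_sub, map_sub, mul_smul_comm, map_smul, smul_eq_mul, sub_mul, one_mul, map_sub] at hM
    have h1 : τ (c * R) - τ (p * (c * R)) ≤ δ * (‖z‖ * τ q) := by
      rw [hpk]
      have : δ * τ (z * (c * R)) ≤ δ * (‖z‖ * τ q) := by
        gcongr; exact hzk.trans (by gcongr)
      linarith
    have h2 := mul_le_mul_of_nonneg_left h1 (by positivity : 0 ≤ ‖c‖ + 1)
    linarith
  have hle0 : τ ((1 - p) * c) ≤ 0 := by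
    have hlim : Tendsto (fun δ : ℝ => δ * ((‖c‖ + 1) * ‖z‖ * τ q)) (𝓝[>] 0) (𝓝 0) := by
      have : Continuous fun δ : ℝ => δ * ((‖c‖ + 1) * ‖z‖ * τ q) := by fun_prop
      simpa using (this.tendsto 0).mono_left nhdsWithin_le_nhds
    refine ge_of_tendsto hlim ?_
    filter_upwards [Ioc_mem_nhdsGT (zero_lt_one' ℝ)] with δ hδ using key δ hδ.1 hδ.2
  have hv : s * (1 - p) = 0 := by
    rw [← CStarRing.star_mul_self_eq_zero_iff]
    refine hfaith _ (star_mul_self_nonneg _) (le_antisymm ?_ (hpos _ (star_mul_self_nonneg _)))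
    have : τ (star (s * (1 - p)) * (s * (1 - p))) = τ ((1 - p) * c) := by
      rw [star_mul, hs, hp1s, mul_assoc, htr, ← mul_assoc s, hsc, mul_assoc, hp1p, htr]
    exact this.trans_le hle0
  have hsp : s = s * p := by rwa [mul_sub, mul_one, sub_eq_zero] at hv
  have hcz : c = c * z * c := by
    calc c = s * p * s := by rw [← hsp, hsc]
      _ = (s * s) * z * (s * s) := by rw [hpdef]; simp only [mul_assoc]
      _ = c * z * c := by rw [hsc]
  refine ⟨‖z‖, ?_⟩
  have := star_left_conjugate_nonneg hzK c
  rw [hc.isSelfAdjoint.star_eq, mul_sub, sub_mul, ← hcz, sub_nonneg] at this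
  simpa using this

lemma le_mul_sq_of_mem_spectrum {c : B} (hc : 0 ≤ c) {K : ℝ} (hle : c ≤ K • (c * c)) {t : ℝ}
    (ht : t ∈ spectrum ℝ c) : t ≤ K * (t * t) := by
  have hsa : IsSelfAdjoint c := hc.isSelfAdjoint
  have h1 : cfc (fun t : ℝ => t) c ≤ cfc (fun t : ℝ => K * (t * t)) c := by
    rw [cfc_const_mul K (fun t : ℝ => t * t) c, cfc_mul (fun t : ℝ => t) (fun t => t) c,
      cfc_id' ℝ c]
    exact hle
  exact (cfc_le_iff _ _ c).mp h1 t ht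

/-- A positive element whose spectrum has a gap above zero is Cuntz equivalent to a projection. -/
lemma exists_cuntzEquiv_projection_of_spectrum {c : B} (hc : 0 ≤ c) {K : ℝ}
    (hK : ∀ t ∈ spectrum ℝ c, t ≤ K * (t * t)) :
    ∃ p : B, star p = p ∧ p * p = p ∧ CuntzEquiv c p := by
  have hsa : IsSelfAdjoint c := hc.isSelfAdjoint
  have hnn : ∀ t ∈ spectrum ℝ c, 0 ≤ t := fun t ht => spectrum_nonneg_of_nonneg hc ht
  have hcont : ContinuousOn (fun t : ℝ => (√t)⁻¹) (spectrum ℝ c) := by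
    intro t ht
    rcases (hnn t ht).eq_or_lt with rfl | hpos
    · refine (continuousWithinAt_const (b := (√(0 : ℝ))⁻¹)).congr_of_eventuallyEq ?_ rfl
      have hnear : ∀ᶠ t in 𝓝[spectrum ℝ c] (0 : ℝ), K * t < 1 := by
        have : Continuous fun t : ℝ => K * t := by fun_prop
        exact (this.tendsto 0).mono_left nhdsWithin_le_nhds |>.eventually_lt_const (by simp)
      filter_upwards [hnear, self_mem_nhdsWithin] with t ht1 ht2
      have : t = 0 := le_antisymm (not_lt.mp fun h => by
        nlinarith [hK t ht2, mul_pos h (sub_pos.mpr ht1)]) (hnn t ht2)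
      rw [this]
    · exact ((Real.continuous_sqrt.continuousAt).inv₀
        (Real.sqrt_pos.mpr hpos).ne').continuousWithinAt
  have hsqrt : ContinuousOn (fun t : ℝ => √t) (spectrum ℝ c) := Real.continuous_sqrt.continuousOn
  set s := cfc (fun t : ℝ => √t) c with hs
  set r := cfc (fun t : ℝ => (√t)⁻¹) c with hr
  have hss : star s = s := IsSelfAdjoint.star_eq (cfc_predicate _ c)
  have hrs : star r = r := IsSelfAdjoint.star_eq (cfc_predicate _ c)
  have hsq : s * s = c := by
    rw [hs, ← cfc_mul (fun t : ℝ => √t) (fun t : ℝ => √t) c hsqrt hsqrt]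
    conv_rhs => rw [← cfc_id' ℝ c]
    exact cfc_congr fun t ht => Real.mul_self_sqrt (hnn t ht)
  have hsr : Commute s r := cfc_commute_cfc (fun t : ℝ => √t) (fun t : ℝ => (√t)⁻¹) c
  have hsrs : s * r * s = s := by
    rw [hs, hr, ← cfc_mul (fun t : ℝ => √t) (fun t : ℝ => (√t)⁻¹) c hsqrt hcont,
      ← cfc_mul (fun t : ℝ => √t * (√t)⁻¹) (fun t : ℝ => √t) c (hsqrt.mul hcont) hsqrt]
    exact cfc_congr fun t ht => mul_inv_mul_cancel _
  have hrsr : r * s * r = r := by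
    rw [hs, hr, ← cfc_mul (fun t : ℝ => (√t)⁻¹) (fun t : ℝ => √t) c hcont hsqrt,
      ← cfc_mul (fun t : ℝ => (√t)⁻¹ * √t) (fun t : ℝ => (√t)⁻¹) c (hcont.mul hsqrt) hcont]
    refine cfc_congr fun t ht => ?_
    simpa using mul_inv_mul_cancel (√t)⁻¹
  refine ⟨s * r, ?_, ?_, ⟨fun _ => s, ?_⟩, ⟨fun _ => r, ?_⟩⟩
  · rw [star_mul, hss, hrs, hsr.eq]
  · rw [← mul_assoc, hsrs]
  · have : s * (s * r) * star s = c := by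
      rw [hss, mul_assoc, hsrs, hsq]
    simp only [this]; exact tendsto_const_nhds
  · have : r * c * star r = s * r := by
      rw [hrs, ← hsq, mul_assoc, mul_assoc, ← mul_assoc r, ← hsr.eq, ← mul_assoc, hsrs]
    simp only [this]; exact tendsto_const_nhds

end TraceLemmas

section Diagonal

variable {A : Type*} [CStarAlgebra A]

lemma spectrum_subset_spectrum_diagonal (a b : A) :
    spectrum ℝ a ⊆ spectrum ℝ (CStarMatrix.ofMatrix (Matrix.diagonal ![a, b])) := by
  intro t ht hu
  refine ht ?_
  obtain ⟨⟨x, y, hxy, hyx⟩, hx⟩ := hu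
  have h00 : x 0 0 = algebraMap ℝ A t - a := by
    rw [show x = _ from hx]
    simp [Algebra.algebraMap_eq_smul_one]
  have h01 : x 0 1 = 0 := by
    rw [show x = _ from hx]
    simp [Algebra.algebraMap_eq_smul_one]
  have h10 : x 1 0 = 0 := by
    rw [show x = _ from hx]
    simp [Algebra.algebraMap_eq_smul_one]
  have e1 := congrFun (congrFun hxy 0) 0
  have e2 := congrFun (congrFun hyx 0) 0
  simp only [CStarMatrix.mul_apply, Fin.sum_univ_two, h01, h10, h00, zero_mul, mul_zero, add_zero,
    CStarMatrix.one_apply_eq] at e1 e2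
  exact ⟨⟨_, _, e1, e2⟩, rfl⟩

/-- The unnormalised real-valued trace on `M₂(A)` induced by a functional on `A`. -/
noncomputable def matrixTrace (τ : A →ₗ[ℂ] ℂ) : CStarMatrix (Fin 2) (Fin 2) A →ₗ[ℝ] ℝ where
  toFun M := (τ (M 0 0) + τ (M 1 1)).re
  map_add' M N := by simp; ring
  map_smul' r M := by
    simp [← Complex.coe_smul]
    ring

lemma matrixTrace_apply (τ : A →ₗ[ℂ] ℂ) (M : CStarMatrix (Fin 2) (Fin 2) A) :
    matrixTrace τ M = (τ (M 0 0) + τ (M 1 1)).re := rfl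

lemma matrixTrace_mul_comm {τ : A →ₗ[ℂ] ℂ} (htr : ∀ x y, τ (x * y) = τ (y * x))
    (M N : CStarMatrix (Fin 2) (Fin 2) A) : matrixTrace τ (M * N) = matrixTrace τ (N * M) := by
  simp only [matrixTrace_apply, CStarMatrix.mul_apply, Fin.sum_univ_two, map_add]
  rw [htr (M 0 0), htr (M 0 1), htr (M 1 0), htr (M 1 1)]
  congr 1
  ring

lemma matrixTrace_star_mul_self {τ : A →ₗ[ℂ] ℂ} (M : CStarMatrix (Fin 2) (Fin 2) A) :
    matrixTrace τ (star M * M) = ∑ j, ∑ i, (τ (star (M i j) * M i j)).re := by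
  simp [matrixTrace_apply, CStarMatrix.mul_apply, CStarMatrix.star_apply, Fin.sum_univ_two]

variable [PartialOrder A] [StarOrderedRing A]

lemma diagonal_nonneg {a b : A} (ha : 0 ≤ a) (hb : 0 ≤ b) :
    0 ≤ CStarMatrix.ofMatrix (Matrix.diagonal ![a, b]) := by
  obtain ⟨u, rfl⟩ := exists_eq_star_mul_self_of_nonneg ha
  obtain ⟨v, rfl⟩ := exists_eq_star_mul_self_of_nonneg hb
  convert star_mul_self_nonneg (CStarMatrix.ofMatrix (Matrix.diagonal ![u, v]))
  ext i j
  fin_cases i <;> fin_cases j <;>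
    simp [CStarMatrix.mul_apply, CStarMatrix.star_apply, Fin.sum_univ_two]

open scoped ComplexOrder

lemma matrixTrace_nonneg {τ : A →ₗ[ℂ] ℂ} (hpos : ∀ x, 0 ≤ x → 0 ≤ τ x)
    (M : CStarMatrix (Fin 2) (Fin 2) A) (hM : 0 ≤ M) : 0 ≤ matrixTrace τ M := by
  obtain ⟨N, rfl⟩ := exists_eq_star_mul_self_of_nonneg hM
  rw [matrixTrace_star_mul_self]
  exact Finset.sum_nonneg fun j _ => Finset.sum_nonneg fun i _ =>
    (Complex.le_def.mp (hpos _ (star_mul_self_nonneg _))).1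

lemma eq_zero_of_matrixTrace_eq_zero {τ : A →ₗ[ℂ] ℂ} (hpos : ∀ x, 0 ≤ x → 0 ≤ τ x)
    (hfaith : ∀ x, 0 ≤ x → x ≠ 0 → 0 < τ x) (M : CStarMatrix (Fin 2) (Fin 2) A) (hM : 0 ≤ M)
    (h : matrixTrace τ M = 0) : M = 0 := by
  obtain ⟨N, rfl⟩ := exists_eq_star_mul_self_of_nonneg hM
  have hnn : ∀ i j, 0 ≤ (τ (star (N i j) * N i j)).re := fun i j =>
    (Complex.le_def.mp (hpos _ (star_mul_self_nonneg _))).1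
  suffices N = 0 by rw [this, mul_zero]
  rw [matrixTrace_star_mul_self,
    Finset.sum_eq_zero_iff_of_nonneg fun j _ => Finset.sum_nonneg fun i _ => hnn i j] at h
  ext i j
  have hij := (Finset.sum_eq_zero_iff_of_nonneg fun i _ => hnn i j).mp
    (h j (Finset.mem_univ j)) i (Finset.mem_univ i)
  by_contra hne
  have := (Complex.lt_def.mp (hfaith _ (star_mul_self_nonneg (N i j))
    (fun h0 => hne (CStarRing.star_mul_self_eq_zero_iff _ |>.mp h0)))).1
  exact this.ne' hij

lemma continuous_matrixTrace {τ : A →ₗ[ℂ] ℂ} (hpos : ∀ x, 0 ≤ x → 0 ≤ τ x) :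
    Continuous (matrixTrace τ) := by
  have hτ : Continuous τ := map_continuous (PositiveLinearMap.mk₀ τ hpos)
  have hentry (i j : Fin 2) : Continuous fun M : CStarMatrix (Fin 2) (Fin 2) A => M i j :=
    continuous_apply_apply (ρ := fun _ _ => A) i j
  exact Complex.continuous_re.comp ((hτ.comp (hentry 0 0)).add (hτ.comp (hentry 1 1)))

end Diagonal

open scoped ComplexOrder in
/-- In a simple unital C*-algebra with a faithful tracial state, if neither of the positive
elements `a`, `b` is Cuntz equivalent to a projection, then `diag (a, b) ∈ M₂(A)` is not Cuntz
equivalent to any projection in `M₂(A)`. -/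
theorem diag_purely_positive_not_cuntzEquiv_projection {A : Type*} [CStarAlgebra A]
    [PartialOrder A] [StarOrderedRing A]
    (hsimple : ∀ I : TwoSidedIdeal A, IsClosed (I : Set A) → I = ⊥ ∨ I = ⊤)
    (hstate : ∃ τ : A →ₗ[ℂ] ℂ, IsTracialState τ ∧ ∀ a : A, 0 ≤ a → a ≠ 0 → 0 < τ a)
    (a b : A) (ha : 0 ≤ a) (hb : 0 ≤ b)
    (hap : ∀ p : A, star p = p → p * p = p → ¬ CuntzEquiv a p)
    (hbp : ∀ p : A, star p = p → p * p = p → ¬ CuntzEquiv b p) :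
    ∀ q : Matrix (Fin 2) (Fin 2) A, star q = q → q * q = q →
      ¬ CuntzEquiv (Matrix.diagonal ![a, b]) q := by
  intro q hqs hq hcq
  obtain ⟨τ, ⟨hpos, -, htr⟩, hfaith⟩ := hstate
  have heq : CuntzEquiv (CStarMatrix.ofMatrix (Matrix.diagonal ![a, b]))
      (CStarMatrix.ofMatrix q) := hcq
  obtain ⟨K, hK⟩ := exists_le_smul_sq_of_cuntzEquiv (continuous_matrixTrace hpos)
    (matrixTrace_nonneg hpos) (eq_zero_of_matrixTrace_eq_zero hpos hfaith)
    (matrixTrace_mul_comm htr) (q := CStarMatrix.ofMatrix q) hqs hq (diagonal_nonneg ha hb) heq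
  obtain ⟨p, hps, hpp, hap'⟩ := exists_cuntzEquiv_projection_of_spectrum ha fun t ht =>
    le_mul_sq_of_mem_spectrum (diagonal_nonneg ha hb) hK (spectrum_subset_spectrum_diagonal a b ht)
  exact hap p hps hpp hap'
end

section
/- Let A be a unital C*-algebra with a unique tracial state τ. Suppose there exists a positive element a ∈ A with spectrum σ(a) = [0,1], and let μ be the Borel probability measure on [0,1] determined by τ(f(a)) = ∫ f dμ for every continuous real-valued function f on [0,1] (f(a) taken via continuous functional calculus). If μ has no atoms, then for every λ ∈ (0,1] there exists a positive element g ∈ A with d_τ(g) = λ. -/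
open Filter Topology

open MeasureTheory ProbabilityTheory in
/-- The cumulative distribution function of an atomless probability measure is continuous. -/
theorem continuous_cdf_of_atomless (μ : Measure ℝ) [IsProbabilityMeasure μ]
    (hatoms : ∀ x : ℝ, μ {x} = 0) : Continuous (cdf μ) := by
  refine continuous_iff_continuousAt.2 fun x => ?_
  rw [(monotone_cdf μ).continuousAt_iff_leftLim_eq_rightLim, (cdf μ).rightLim_eq]
  refine le_antisymm ((monotone_cdf μ).leftLim_le le_rfl) ?_
  have h := (cdf μ).measure_singleton x
  rw [measure_cdf, hatoms, eq_comm, ENNReal.ofReal_eq_zero] at h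
  linarith

open MeasureTheory in
/-- The integrals of `f ^ (1 / n)` converge to the measure of `{f > 0}` when `0 ≤ f` and
`f ≤ 1` almost everywhere. -/
theorem tendsto_integral_rpow_inv (μ : Measure ℝ) [IsProbabilityMeasure μ] (f : ℝ → ℝ)
    (hf : Continuous f) (hf0 : ∀ t, 0 ≤ f t) (hf1 : ∀ᵐ t ∂μ, f t ≤ 1) :
    Tendsto (fun n : ℕ => ∫ t, f t ^ ((n : ℝ)⁻¹) ∂μ) atTop (𝓝 (μ.real {t | 0 < f t})) := by
  have hm : MeasurableSet {t | 0 < f t} := measurableSet_lt measurable_const hf.measurable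
  rw [← integral_indicator_one hm]
  refine tendsto_integral_of_dominated_convergence (fun _ => 1)
    (fun n => (hf.measurable.pow_const _).aestronglyMeasurable) (integrable_const _)
    (fun n => ?_) (ae_of_all _ fun t => ?_)
  · filter_upwards [hf1] with t ht
    rw [Real.norm_of_nonneg (Real.rpow_nonneg (hf0 t) _)]
    exact Real.rpow_le_one (hf0 t) ht (by positivity)
  · rcases (hf0 t).eq_or_lt with h | h
    · have : t ∉ {t | 0 < f t} := by simp [← h]
      rw [Set.indicator_of_notMem this, ← h]
      refine tendsto_const_nhds.congr' ?_
      filter_upwards [eventually_ne_atTop 0] with n hn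
      rw [Real.zero_rpow (by simpa using hn)]
    · have : t ∈ {t | 0 < f t} := h
      rw [Set.indicator_of_mem this]
      have h0 := (Real.continuousAt_const_rpow h.ne' (b := 0)).tendsto.comp
        (tendsto_inv_atTop_nhds_zero_nat (𝕜 := ℝ))
      simpa [Function.comp_def] using h0

open MeasureTheory in
open scoped ComplexOrder in
/-- In a unital C*-algebra with a unique tracial state `τ`, if there is a positive element `a`
with spectrum `[0,1]` such that the measure `μ` induced by `τ` on the spectrum via the
continuous functional calculus has no atoms, then every `λ ∈ (0,1]` is the value `d_τ(g)` of
some positive element `g`. -/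
theorem exists_dTr_eq_of_atomless {A : Type*} [CStarAlgebra A] [PartialOrder A]
    [StarOrderedRing A] (τ : A →ₗ[ℂ] ℂ) (hτ : IsTracialState τ)
    (huniq : ∀ τ' : A →ₗ[ℂ] ℂ, IsTracialState τ' → τ' = τ)
    (a : A) (ha : 0 ≤ a) (hspec : spectrum ℝ a = Set.Icc 0 1)
    (μ : Measure ℝ) (hprob : IsProbabilityMeasure μ)
    (hsupp : μ (Set.Icc (0 : ℝ) 1)ᶜ = 0)
    (hμ : ∀ f : ℝ → ℝ, Continuous f → τ (cfc f a) = ((∫ t, f t ∂μ : ℝ) : ℂ))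
    (hatoms : ∀ x : ℝ, μ {x} = 0) :
    ∀ lam : ℝ, lam ∈ Set.Ioc (0 : ℝ) 1 → ∃ g : A, 0 ≤ g ∧ dTr τ g = lam := by
  intro lam hlam
  have hcdf0 : ProbabilityTheory.cdf μ 0 = 0 := by
    have h : μ (Set.Iio 0) = 0 :=
      measure_mono_null (fun x (hx : x < 0) (h : x ∈ Set.Icc (0 : ℝ) 1) => not_le.2 hx h.1) hsupp
    rw [ProbabilityTheory.cdf_eq_real, measureReal_eq_zero_iff, ← Set.Iio_union_right]
    exact measure_union_null h (hatoms 0)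
  have hcdf1 : ProbabilityTheory.cdf μ 1 = 1 := by
    rw [ProbabilityTheory.cdf_eq_real, measureReal_def,
      (prob_compl_eq_zero_iff measurableSet_Iic).1
        (measure_mono_null (Set.compl_subset_compl.2 Set.Icc_subset_Iic_self) hsupp),
      ENNReal.toReal_one]
  obtain ⟨s, hs, hslam⟩ : lam ∈ ProbabilityTheory.cdf μ '' Set.Icc 0 1 :=
    intermediate_value_Icc zero_le_one (continuous_cdf_of_atomless μ hatoms).continuousOn
      (by rw [hcdf0, hcdf1]; exact ⟨hlam.1.le, hlam.2⟩)
  let f : ℝ → ℝ := fun t => max (s - t) 0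
  have hf : Continuous f := by fun_prop
  have hf0 : ∀ t, 0 ≤ f t := fun t => le_max_right _ _
  have hf1 : ∀ᵐ t ∂μ, f t ≤ 1 := by
    filter_upwards [show ∀ᵐ t ∂μ, t ∈ Set.Icc (0 : ℝ) 1 from hsupp] with t ht
    exact max_le (by linarith [ht.1, hs.2]) zero_le_one
  have hset : μ.real {t | 0 < f t} = lam := by
    have : {t | 0 < f t} = Set.Iio s := by ext t; simp [f]
    rw [this, ← hslam, ProbabilityTheory.cdf_eq_real, measureReal_def, measureReal_def,
      ← Set.Iio_union_right,
      measure_congr (union_ae_eq_left_of_ae_eq_empty (ae_eq_empty.2 (hatoms s)))]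
  refine ⟨cfc f a, cfc_nonneg fun t _ => hf0 t, ?_⟩
  refine Tendsto.limUnder_eq ?_
  rw [← hset]
  refine (tendsto_integral_rpow_inv μ f hf hf0 hf1).congr fun n => ?_
  have hn : Continuous fun t : ℝ => t ^ ((n : ℝ)⁻¹) := Real.continuous_rpow_const (by positivity)
  rw [← cfc_comp' (fun t : ℝ => t ^ ((n : ℝ)⁻¹)) f a hn.continuousOn hf.continuousOn,
    hμ (fun t => f t ^ ((n : ℝ)⁻¹)) (hn.comp hf), Complex.ofReal_re]
end

section
/- Let A be a unital C*-algebra, let p ∈ A be a projection, and let a ∈ A be a positive element with p ≤ a. Then both p and (1−p)a(1−p) belong to the hereditary C*-subalgebra of A generated by a, and consequently p + (1−p)a(1−p) ≾ a. -/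
open Filter Topology

/-- In a C*-algebra, a positive `a` admits self-adjoint `s n` commuting with `a` such that
`s n * a * s n` is a contractive approximate unit for `a`. -/
theorem exists_seq_approximate_unit {A : Type*} [CStarAlgebra A] [PartialOrder A]
    [StarOrderedRing A] {a : A} (ha : 0 ≤ a) :
    ∃ s : ℕ → A, (∀ n, star (s n) = s n) ∧ (∀ n, Commute (s n) a) ∧
      (∀ n, ‖1 - s n * a * s n‖ ≤ 1) ∧
      Tendsto (fun n => (1 - s n * a * s n) * a) atTop (𝓝 0) := by
  have ha' : IsSelfAdjoint a := ha.isSelfAdjoint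
  have hspec : ∀ x ∈ spectrum ℝ a, 0 ≤ x := fun x hx => spectrum_nonneg_of_nonneg ha hx
  let ε : ℕ → ℝ := fun n => 1 / ((n : ℝ) + 1)
  have hε : ∀ n, 0 < ε n := fun n => Nat.one_div_pos_of_nat
  let f : ℕ → ℝ → ℝ := fun n x => (√(x + ε n))⁻¹
  have hf : ∀ n, ContinuousOn (f n) (spectrum ℝ a) := fun n =>
    ContinuousOn.inv₀ (by fun_prop) fun x hx =>
      (Real.sqrt_pos.2 (add_pos_of_nonneg_of_pos (hspec x hx) (hε n))).ne'
  let g : ℕ → ℝ → ℝ := fun n x => ε n / (x + ε n)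
  have hg : ∀ n, ContinuousOn (g n) (spectrum ℝ a) := fun n =>
    ContinuousOn.div (by fun_prop) (by fun_prop) fun x hx =>
      (add_pos_of_nonneg_of_pos (hspec x hx) (hε n)).ne'
  have hsub : ∀ n, 1 - cfc (f n) a * a * cfc (f n) a = cfc (g n) a := by
    intro n
    have h1 : cfc (f n) a * a * cfc (f n) a = cfc (fun x => f n x * x * f n x) a := by
      rw [cfc_mul (fun x => f n x * x) (f n) a ((hf n).mul continuousOn_id) (hf n),
        cfc_mul (f n) (fun x => x) a (hf n) continuousOn_id, cfc_id' ℝ a]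
    rw [h1, ← cfc_one ℝ a, ← cfc_sub (1 : ℝ → ℝ) (fun x => f n x * x * f n x) a
      continuousOn_const (((hf n).mul continuousOn_id).mul (hf n))]
    refine cfc_congr fun x hx => ?_
    have hx0 : 0 < x + ε n := add_pos_of_nonneg_of_pos (hspec x hx) (hε n)
    have hsq : f n x * x * f n x = x / (x + ε n) := by
      simp only [f]
      rw [mul_right_comm, ← mul_inv, Real.mul_self_sqrt hx0.le]
      ring
    simp only [hsq, Pi.one_apply, g]
    field_simp
    ring
  refine ⟨fun n => cfc (f n) a, fun n => cfc_predicate (f n) a,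
    fun n => ?_, fun n => ?_, ?_⟩
  · simpa only [cfc_id ℝ a] using cfc_commute_cfc (f n) id a
  · rw [hsub]
    refine norm_cfc_le zero_le_one fun x hx => ?_
    have hx0 := hspec x hx
    have := hε n
    rw [Real.norm_of_nonneg (by positivity)]
    exact div_le_one_of_le₀ (by linarith) (by positivity)
  · refine squeeze_zero_norm (a := ε) (fun n => ?_) tendsto_one_div_add_atTop_nhds_zero_nat
    have h2 : cfc (g n) a * a = cfc (fun x => g n x * x) a := by
      rw [cfc_mul (g n) (fun x => x) a (hg n) continuousOn_id, cfc_id' ℝ a]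
    rw [hsub, h2]
    have := hε n
    refine norm_cfc_le this.le fun x hx => ?_
    have hx0 := hspec x hx
    rw [Real.norm_of_nonneg (by positivity)]
    simp only [g]
    rw [div_mul_eq_mul_div, div_le_iff₀ (by positivity)]
    nlinarith

/-- A contractive sequence that annihilates `c` asymptotically from the left also annihilates
asymptotically any `b` with `b * star b ≤ c`. -/
theorem tendsto_mul_zero_of_mul_star_le {A : Type*} [CStarAlgebra A] [PartialOrder A]
    [StarOrderedRing A] {v : ℕ → A} (hv : ∀ n, ‖v n‖ ≤ 1) {b c : A} (hbc : b * star b ≤ c)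
    (hc : Tendsto (fun n => v n * c) atTop (𝓝 0)) :
    Tendsto (fun n => v n * b) atTop (𝓝 0) := by
  have hsq : Tendsto (fun n => √‖v n * c‖) atTop (𝓝 0) := by
    simpa [Function.comp_def] using (Real.continuous_sqrt.tendsto _).comp hc.norm
  refine squeeze_zero_norm (fun n => Real.le_sqrt_of_sq_le ?_) hsq
  calc ‖v n * b‖ ^ 2 = ‖v n * (b * star b) * star (v n)‖ := by
        rw [sq, ← CStarRing.norm_self_mul_star, star_mul]
        simp only [mul_assoc]
    _ ≤ ‖v n * c * star (v n)‖ :=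
        CStarAlgebra.norm_le_norm_of_nonneg_of_le
          (star_right_conjugate_nonneg (mul_star_self_nonneg b) _)
          (star_right_conjugate_le_conjugate hbc _)
    _ ≤ ‖v n * c‖ * ‖star (v n)‖ := norm_mul_le _ _
    _ ≤ ‖v n * c‖ := mul_le_of_le_one_right (norm_nonneg _) (by simpa using hv n)

/-- A self-adjoint element for which `s n * a * s n` acts as a left approximate unit lies in the
closure of `a A a`. -/
theorem mem_closure_of_tendsto_one_sub_mul {A : Type*} [CStarAlgebra A] {a c : A} {s : ℕ → A}
    (ha : star a = a) (hs : ∀ n, star (s n) = s n) (hcomm : ∀ n, Commute (s n) a)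
    (hv : ∀ n, ‖1 - s n * a * s n‖ ≤ 1) (hc : star c = c)
    (h : Tendsto (fun n => (1 - s n * a * s n) * c) atTop (𝓝 0)) :
    c ∈ closure {x : A | ∃ y : A, x = a * y * a} := by
  have hstar : ∀ n, star (1 - s n * a * s n) = 1 - s n * a * s n := fun n => by
    simp [ha, hs, mul_assoc]
  have h' : Tendsto (fun n => c * (1 - s n * a * s n)) atTop (𝓝 0) := by
    simpa [-star_sub, hstar, hc] using h.star
  have hvcv : Tendsto (fun n => (1 - s n * a * s n) * c * (1 - s n * a * s n)) atTop (𝓝 0) := by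
    refine squeeze_zero_norm (fun n => ?_) (tendsto_zero_iff_norm_tendsto_zero.1 h)
    exact (norm_mul_le _ _).trans (mul_le_of_le_one_right (norm_nonneg _) (hv n))
  have hlim : Tendsto (fun n => a * (s n * s n * c * (s n * s n)) * a) atTop (𝓝 c) := by
    have := ((tendsto_const_nhds (x := c)).sub h).sub h' |>.add hvcv
    simp only [sub_zero, add_zero] at this
    refine this.congr fun n => ?_
    have hl : s n * a * s n = a * (s n * s n) := by rw [(hcomm n).eq, mul_assoc]
    have hr : s n * a * s n = s n * s n * a := by rw [mul_assoc, ← (hcomm n).eq, mul_assoc]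
    calc _ = (s n * a * s n) * c * (s n * a * s n) := by noncomm_ring
      _ = (a * (s n * s n)) * c * (s n * s n * a) := by rw [← hl, ← hr]
      _ = _ := by simp only [mul_assoc]
  exact mem_closure_of_tendsto hlim (Eventually.of_forall fun n => ⟨_, rfl⟩)

/-- A positive element for which `s n * a * s n` acts as a left approximate unit is Cuntz
subequivalent to `a`. -/
theorem cuntzLE_of_tendsto_one_sub_mul {A : Type*} [CStarAlgebra A] [PartialOrder A]
    [StarOrderedRing A] {a c : A} {s : ℕ → A} (hs : ∀ n, star (s n) = s n)
    (hv : ∀ n, ‖1 - s n * a * s n‖ ≤ 1) (hc : 0 ≤ c)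
    (h : Tendsto (fun n => (1 - s n * a * s n) * c) atTop (𝓝 0)) :
    CuntzLE c a := by
  have hr : star (CFC.sqrt c) = CFC.sqrt c := (CFC.sqrt_nonneg c).isSelfAdjoint
  have hrr : CFC.sqrt c * CFC.sqrt c = c := CFC.sqrt_mul_sqrt_self c
  have hlim := tendsto_mul_zero_of_mul_star_le hv (b := CFC.sqrt c) (by rw [hr, hrr]) h
  refine ⟨fun n => CFC.sqrt c * s n, ?_⟩
  have := (tendsto_const_nhds (x := c)).sub (hlim.const_mul (CFC.sqrt c))
  simp only [mul_zero, sub_zero] at this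
  refine this.congr fun n => ?_
  rw [star_mul, hr, hs]
  nth_rw 1 [← hrr]
  noncomm_ring

/-- If `p` is a projection in a unital C*-algebra and `a` is positive with `p ≤ a`, then
`p` and `(1-p) a (1-p)` belong to the hereditary C*-subalgebra generated by `a` (the closure
of `a A a`), and consequently `p + (1-p) a (1-p) ≾ a`. -/
theorem mem_hereditary_and_cuntzLE {A : Type*} [CStarAlgebra A] [PartialOrder A]
    [StarOrderedRing A] (p a : A) (hp_star : star p = p) (hp_idem : p * p = p)
    (ha : 0 ≤ a) (hpa : p ≤ a) :
    p ∈ closure {x : A | ∃ y : A, x = a * y * a} ∧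
    (1 - p) * a * (1 - p) ∈ closure {x : A | ∃ y : A, x = a * y * a} ∧
    CuntzLE (p + (1 - p) * a * (1 - p)) a := by
  obtain ⟨s, hs, hcomm, hv, hva⟩ := exists_seq_approximate_unit ha
  have ha_star : star a = a := ha.isSelfAdjoint
  have hpp : p * star p = p := by rw [hp_star, hp_idem]
  have hp0 : 0 ≤ p := hpp ▸ mul_star_self_nonneg p
  have hq : star (1 - p) = 1 - p := by rw [star_sub, star_one, hp_star]
  have hd0 : 0 ≤ (1 - p) * a * (1 - p) := by
    simpa only [hq] using star_right_conjugate_nonneg ha (1 - p)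
  have hvp := tendsto_mul_zero_of_mul_star_le hv (hpp.trans_le hpa) hva
  have hvd : Tendsto (fun n => (1 - s n * a * s n) * ((1 - p) * a * (1 - p))) atTop (𝓝 0) := by
    have := (hva.mul_const (1 - p)).sub (hvp.mul_const (a * (1 - p)))
    simp only [zero_mul, sub_zero] at this
    refine this.congr fun n => ?_
    noncomm_ring
  refine ⟨mem_closure_of_tendsto_one_sub_mul ha_star hs hcomm hv hp_star hvp,
    mem_closure_of_tendsto_one_sub_mul ha_star hs hcomm hv hd0.isSelfAdjoint hvd,
    cuntzLE_of_tendsto_one_sub_mul hs hv (add_nonneg hp0 hd0) ?_⟩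
  simpa only [mul_add, add_zero] using hvp.add hvd
end
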